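/- Let P ⊂ ℝ² be a lattice polygon with P ⊂ [0,∞)² that contains a lattice translate of 5Δ. Then for a generic polynomial f ∈ ℂ^{P∩ℤ²}, the set {p ∈ T : f(p) = 0 and (∂f/∂y)(p) = 0} (the set of points of the curve {f=0} with vertical tangent line) is finite and has cardinality 2·vol(P) − len(P^↓) − len(P^↑). -/

import Mathlib

open scoped Pointwise
open MvPolynomial

noncomputable section

/-- The torus `(ℂ ∖ {0})²`. -/
def Torus : Set (ℂ × ℂ) := {p | p.1 ≠ 0 ∧ p.2 ≠ 0}

/-- Evaluation of a bivariate polynomial at a point of `ℂ²`. -/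
def evalP (f : MvPolynomial (Fin 2) ℂ) (p : ℂ × ℂ) : ℂ :=
  MvPolynomial.eval (fun i => if i = 0 then p.1 else p.2) f

/-- The affine line through `p` with direction `w`, as a subset of `ℂ²`. -/
def lineThrough (p w : ℂ × ℂ) : Set (ℂ × ℂ) :=
  {q | ∃ t : ℂ, q = (p.1 + t * w.1, p.2 + t * w.2)}

/-- The univariate polynomial `t ↦ f (p + t • w)`. -/
def lineRestrict (f : MvPolynomial (Fin 2) ℂ) (p w : ℂ × ℂ) : Polynomial ℂ :=
  MvPolynomial.aeval
    (fun i => if i = 0 then Polynomial.C p.1 + Polynomial.C w.1 * Polynomial.X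
              else Polynomial.C p.2 + Polynomial.C w.2 * Polynomial.X) f

/-- Intersection multiplicity at `p` of the curve `{f = 0}` and the line through `p`
with direction `w` (as `ℕ∞`; it is `⊤` if the line lies inside the curve). -/
def interMult (f : MvPolynomial (Fin 2) ℂ) (p w : ℂ × ℂ) : ℕ∞ :=
  if lineRestrict f p w = 0 then ⊤
  else (Polynomial.rootMultiplicity 0 (lineRestrict f p w) : ℕ∞)

/-- The point of `ℝ²` corresponding to a lattice point. -/
def rpt (k : ℤ × ℤ) : ℝ × ℝ := ((k.1 : ℝ), (k.2 : ℝ))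

/-- The support of `f` is contained in `S ⊆ ℤ²`. -/
def SuppIn (f : MvPolynomial (Fin 2) ℂ) (S : Set (ℤ × ℤ)) : Prop :=
  ∀ m ∈ f.support, ((m 0 : ℤ), (m 1 : ℤ)) ∈ S

/-- The coefficient of `f` at the exponent `k ∈ ℤ²`. -/
def coeffAt (f : MvPolynomial (Fin 2) ℂ) (k : ℤ × ℤ) : ℂ :=
  if 0 ≤ k.1 ∧ 0 ≤ k.2 then
    f.coeff (Finsupp.single (0 : Fin 2) k.1.toNat + Finsupp.single (1 : Fin 2) k.2.toNat)
  else 0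

/-- A property `Q` holds for a generic polynomial supported in `S`: there is a nonzero
polynomial `D` in variables indexed by `S` such that `Q f` holds for every `f` with
support in `S` whose coefficient tuple is not annihilated by `D`. -/
def GenericOn (S : Set (ℤ × ℤ)) (Q : MvPolynomial (Fin 2) ℂ → Prop) : Prop :=
  ∃ D : MvPolynomial S ℂ, D ≠ 0 ∧
    ∀ f : MvPolynomial (Fin 2) ℂ, SuppIn f S →
      MvPolynomial.eval (fun k => coeffAt f k.1) D ≠ 0 → Q f

/-- `P` is a lattice polygon: the convex hull of finitely many lattice points. -/
def IsLatticePolygon (P : Set (ℝ × ℝ)) : Prop :=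
  ∃ V : Finset (ℤ × ℤ), V.Nonempty ∧ P = convexHull ℝ (rpt '' (V : Set (ℤ × ℤ)))

/-- The standard triangle `Δ = conv {(0,0), (1,0), (0,1)}`. -/
def stdTriangle : Set (ℝ × ℝ) := convexHull ℝ {(0, 0), (1, 0), (0, 1)}

/-- The lattice points of a subset of `ℝ²`. -/
def latticePts (P : Set (ℝ × ℝ)) : Set (ℤ × ℤ) := {k | rpt k ∈ P}

/-- The support set (face) of `P` in the direction of the covector `γ`. -/
def face (P : Set (ℝ × ℝ)) (γ : ℤ × ℤ) : Set (ℝ × ℝ) :=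
  {p ∈ P | ∀ q ∈ P, (γ.1 : ℝ) * q.1 + (γ.2 : ℝ) * q.2 ≤ (γ.1 : ℝ) * p.1 + (γ.2 : ℝ) * p.2}

/-- The lattice length of the face of `P` in direction `γ`. -/
def lenFace (P : Set (ℝ × ℝ)) (γ : ℤ × ℤ) : ℕ := (latticePts (face P γ)).ncard - 1

/-- The Euclidean area of a subset of `ℝ²`. -/
def areaOf (P : Set (ℝ × ℝ)) : ℝ := (MeasureTheory.volume P).toReal

/-- The set of inflection points of `{f = 0}` in the torus. -/
def inflPts (f : MvPolynomial (Fin 2) ℂ) : Set (ℂ × ℂ) :=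
  {p | p ∈ Torus ∧ evalP f p = 0 ∧ ∃ w : ℂ × ℂ, w ≠ 0 ∧ 3 ≤ interMult f p w}

/-- The set of lines (as subsets of `ℂ²`) tangent to `{f = 0}` at two distinct
points of the torus. -/
def bitangentLines (f : MvPolynomial (Fin 2) ℂ) : Set (Set (ℂ × ℂ)) :=
  {l | ∃ p w q₁ q₂ : ℂ × ℂ, w ≠ 0 ∧ l = lineThrough p w ∧
    q₁ ∈ lineThrough p w ∩ Torus ∧ q₂ ∈ lineThrough p w ∩ Torus ∧ q₁ ≠ q₂ ∧
    2 ≤ interMult f q₁ w ∧ 2 ≤ interMult f q₂ w}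

/-- `P` contains a lattice translate of `5Δ`. -/
def Contains5Delta (P : Set (ℝ × ℝ)) : Prop :=
  ∃ t : ℤ × ℤ, rpt t +ᵥ ((5 : ℝ) • stdTriangle) ⊆ P

/-- The largest value of `r i + r j` over `i + j = K` when `r` is concave. -/
def midSum (r : ℕ → ℝ) (K : ℕ) : ℝ := r (K / 2) + r (K - K / 2)

/-- Discrete concavity on `{0, …, n}`. -/
def DiscreteConcave (n : ℕ) (r : ℕ → ℝ) : Prop :=
  ∀ i, i + 2 ≤ n → r i + r (i + 2) ≤ 2 * r (i + 1)

/-- `m` is an end of `{0, …, n}` or a point where the slope of `r` drops. -/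
def IsBreak (n : ℕ) (r : ℕ → ℝ) (m : ℕ) : Prop :=
  m = 0 ∨ m = n ∨ (0 < m ∧ m < n ∧ r (m - 1) + r (m + 1) < 2 * r m)

namespace DiscreteConcave

variable {n : ℕ} {r : ℕ → ℝ}

lemma slope_le (h : DiscreteConcave n r) {i j : ℕ} (hij : i ≤ j) (hj : j + 1 ≤ n) :
    r (j + 1) - r j ≤ r (i + 1) - r i := by
  induction j, hij using Nat.le_induction with
  | base => exact le_rfl
  | succ j hij ih =>
    have := h j hj
    have := ih (by omega)
    have e : r (j + 1 + 1) = r (j + 2) := rfl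
    linarith

lemma step_le (h : DiscreteConcave n r) {i j : ℕ} (hij : i < j) (hj : j ≤ n) :
    r i + r j ≤ r (i + 1) + r (j - 1) := by
  obtain ⟨j, rfl⟩ : ∃ j', j = j' + 1 := ⟨j - 1, by omega⟩
  have := h.slope_le (i := i) (j := j) (by omega) hj
  simp only [Nat.add_sub_cancel]
  linarith

lemma step_lt (h : DiscreteConcave n r) {i j m : ℕ} (him : i < m) (hmj : m < j) (hj : j ≤ n)
    (hm : IsBreak n r m) : r i + r j < r (i + 1) + r (j - 1) := by
  obtain ⟨j, rfl⟩ : ∃ j', j = j' + 1 := ⟨j - 1, by omega⟩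
  obtain ⟨m, rfl⟩ : ∃ m', m = m' + 1 := ⟨m - 1, by omega⟩
  have h1 := h.slope_le (i := i) (j := m) (by omega) (by omega)
  have h2 := h.slope_le (i := m + 1) (j := j) (by omega) (by omega)
  rcases hm with hm | hm | ⟨_, _, hm⟩
  · omega
  · omega
  · simp only [Nat.add_sub_cancel] at hm ⊢
    linarith

lemma midSum_of_le_succ {i j : ℕ} (h1 : i ≤ j) (h2 : j ≤ i + 1) :
    midSum r (i + j) = r i + r j := by
  unfold midSum
  have e1 : (i + j) / 2 = i := by omega
  rw [e1, Nat.add_sub_cancel_left]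

lemma add_le_midSum_of_le (h : DiscreteConcave n r) (d : ℕ) :
    ∀ i j : ℕ, i ≤ j → j ≤ n → j - i ≤ d → r i + r j ≤ midSum r (i + j) := by
  induction d using Nat.strong_induction_on with
  | _ d ih =>
    intro i j hij hj hd
    by_cases hs : j ≤ i + 1
    · rw [midSum_of_le_succ hij hs]
    · have h1 := h.step_le (i := i) (j := j) (by omega) hj
      have h2 := ih (d - 1) (by omega) (i + 1) (j - 1) (by omega) (by omega) (by omega)
      have e : i + 1 + (j - 1) = i + j := by omega
      rw [e] at h2
      linarith

lemma add_le_midSum (h : DiscreteConcave n r) {i j : ℕ} (hi : i ≤ n) (hj : j ≤ n) :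
    r i + r j ≤ midSum r (i + j) := by
  rcases le_total i j with hij | hij
  · exact h.add_le_midSum_of_le _ i j hij hj le_rfl
  · rw [add_comm, add_comm i]; exact h.add_le_midSum_of_le _ j i hij hi le_rfl

lemma add_lt_midSum (h : DiscreteConcave n r) {i j m : ℕ} (him : i < m) (hmj : m < j)
    (hj : j ≤ n) (hm : IsBreak n r m) : r i + r j < midSum r (i + j) := by
  have h1 := h.step_lt him hmj hj hm
  have h2 := h.add_le_midSum (i := i + 1) (j := j - 1) (by omega) (by omega)
  have e : i + 1 + (j - 1) = i + j := by omega
  rw [e] at h2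
  linarith

lemma add_eq_midSum_of_le (h : DiscreteConcave n r) (d : ℕ) :
    ∀ i j : ℕ, i ≤ j → j ≤ n → j - i ≤ d → (∀ m, i < m → m < j → ¬ IsBreak n r m) →
      r i + r j = midSum r (i + j) := by
  induction d using Nat.strong_induction_on with
  | _ d ih =>
    intro i j hij hj hd hm
    by_cases hs : j ≤ i + 1
    · rw [midSum_of_le_succ hij hs]
    · have h2 := ih (d - 1) (by omega) (i + 1) (j - 1) (by omega) (by omega) (by omega)
        (fun m h1 h2 => hm m (by omega) (by omega))
      have e : i + 1 + (j - 1) = i + j := by omega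
      rw [e] at h2
      rw [← h2]
      have key : ∀ k, i + 1 + k ≤ j - 1 → r (i + k + 2) - r (i + k + 1) = r (i + 1) - r i := by
        intro k
        induction k with
        | zero =>
          intro hk
          have := hm (i + 1) (by omega) (by omega)
          simp only [IsBreak, not_or, not_and, not_lt, Nat.add_sub_cancel] at this
          have h3 := this.2.2 (by omega) (by omega)
          have h4 := h i (by omega)
          simp only [add_zero]
          have e : r (i + 1 + 1) = r (i + 2) := rfl
          linarith
        | succ k ihk =>
          intro hk
          have h0 := ihk (by omega)
          have := hm (i + k + 2) (by omega) (by omega)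
          simp only [IsBreak, not_or, not_and, not_lt] at this
          have h3 := this.2.2 (by omega) (by omega)
          have h4 := h (i + k + 1) (by omega)
          have e0 : i + k + 2 - 1 = i + k + 1 := by omega
          rw [e0] at h3
          have e1 : i + (k + 1) + 2 = i + k + 1 + 2 := by omega
          have e2 : i + (k + 1) + 1 = i + k + 1 + 1 := by omega
          have e3 : i + k + 2 = i + k + 1 + 1 := by omega
          have e4 : i + k + 2 + 1 = i + k + 1 + 2 := by omega
          rw [e1, e2]; rw [e4, e3] at h3; rw [e3] at h0
          linarith
      obtain ⟨j, rfl⟩ : ∃ j', j = i + j' + 2 := ⟨j - i - 2, by omega⟩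
      have := key j (by omega)
      have e1 : i + j + 2 - 1 = i + j + 1 := by omega
      rw [e1]
      linarith

lemma add_eq_midSum (h : DiscreteConcave n r) {i j : ℕ} (hij : i ≤ j) (hj : j ≤ n)
    (hm : ∀ m, i < m → m < j → ¬ IsBreak n r m) : r i + r j = midSum r (i + j) :=
  h.add_eq_midSum_of_le _ i j hij hj le_rfl hm

end DiscreteConcave

lemma sum_midSum (r : ℕ → ℝ) (n : ℕ) :
    ∑ K ∈ Finset.range (2 * n), midSum r (K + 1) - ∑ j ∈ Finset.range n, r (j + 1)
      - ∑ j ∈ Finset.range n, r j =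
      ∑ j ∈ Finset.range (n + 1), (r j + r (j + 1)) - r 0 - r (n + 1) := by
  induction n with
  | zero => simp
  | succ n ih =>
    rw [show 2 * (n + 1) = 2 * n + 1 + 1 by ring, Finset.sum_range_succ, Finset.sum_range_succ,
      Finset.sum_range_succ _ n, Finset.sum_range_succ _ n, Finset.sum_range_succ _ (n + 1)]
    have e1 : midSum r (2 * n + 1) = r n + r (n + 1) := by
      unfold midSum
      rw [show (2 * n + 1) / 2 = n by omega, show 2 * n + 1 - n = n + 1 by omega]
    have e2 : midSum r (2 * n + 1 + 1) = r (n + 1) + r (n + 1) := by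
      unfold midSum
      rw [show (2 * n + 1 + 1) / 2 = n + 1 by omega, show 2 * n + 1 + 1 - (n + 1) = n + 1 by omega]
    rw [e1, e2]
    linarith

/-- `l` is the coefficient of `g` at the (possibly missing) exponent `p` with `s * p = b`, and
every exponent of `g` satisfies `s * p ≤ b`. -/
def IsLead (s b : ℝ) (g : Polynomial ℂ) (l : ℂ) : Prop :=
  (∀ p : ℕ, b < s * p → g.coeff p = 0) ∧ (∀ p : ℕ, s * p = b → g.coeff p = l) ∧
    (l ≠ 0 → ∃ p : ℕ, s * p = b)

namespace IsLead

variable {s b b' : ℝ} {g h : Polynomial ℂ} {l l' : ℂ}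

lemma zero (s b : ℝ) : IsLead s b 0 0 := ⟨by simp, by simp, by simp⟩

lemma one (hs : s ≠ 0) : IsLead s 0 1 1 := by
  refine ⟨fun p hp => ?_, fun p hp => ?_, fun _ => ⟨0, by simp⟩⟩
  · rw [Polynomial.coeff_one, if_neg]
    rintro rfl
    simp at hp
  · have : p = 0 := by simpa [hs] using hp
    subst this
    simp

lemma add (hg : IsLead s b g l) (hh : IsLead s b h l') : IsLead s b (g + h) (l + l') := by
  refine ⟨fun p hp => by simp [hg.1 p hp, hh.1 p hp],
    fun p hp => by simp [hg.2.1 p hp, hh.2.1 p hp], fun hne => ?_⟩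
  by_cases hl : l = 0
  · exact hh.2.2 (by rintro rfl; simp [hl] at hne)
  · exact hg.2.2 hl

lemma C_mul (a : ℂ) (hg : IsLead s b g l) : IsLead s b (Polynomial.C a * g) (a * l) := by
  refine ⟨fun p hp => by simp [hg.1 p hp], fun p hp => by simp [hg.2.1 p hp], fun hne => ?_⟩
  exact hg.2.2 (right_ne_zero_of_mul hne)

lemma sum {ι : Type*} (t : Finset ι) (G : ι → Polynomial ℂ) (L : ι → ℂ)
    (H : ∀ i ∈ t, IsLead s b (G i) (L i)) : IsLead s b (∑ i ∈ t, G i) (∑ i ∈ t, L i) := by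
  classical
  induction t using Finset.induction_on with
  | empty => simpa using zero s b
  | insert i t hi ih =>
    rw [Finset.sum_insert hi, Finset.sum_insert hi]
    exact (H i (by simp)).add (ih fun j hj => H j (by simp [hj]))

lemma mul (hs : s ≠ 0) (hg : IsLead s b g l) (hh : IsLead s b' h l') :
    IsLead s (b + b') (g * h) (l * l') := by
  refine ⟨fun p hp => ?_, fun p hp => ?_, fun hne => ?_⟩
  · rw [Polynomial.coeff_mul]
    refine Finset.sum_eq_zero fun x hx => ?_
    rw [Finset.HasAntidiagonal.mem_antidiagonal] at hx
    have e : s * (p : ℝ) = s * x.1 + s * x.2 := by rw [← hx]; push_cast; ring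
    by_cases h1 : b < s * x.1
    · rw [hg.1 _ h1, zero_mul]
    · rw [hh.1 x.2 (by linarith), mul_zero]
  · rw [Polynomial.coeff_mul]
    by_cases hex : ∃ p₁ p₂ : ℕ, s * p₁ = b ∧ s * p₂ = b'
    · obtain ⟨p₁, p₂, e₁, e₂⟩ := hex
      have hp' : p₁ + p₂ = p := by
        have : s * ((p₁ + p₂ : ℕ) : ℝ) = s * p := by push_cast; rw [mul_add, e₁, e₂, hp]
        exact_mod_cast mul_left_cancel₀ hs this
      rw [Finset.sum_eq_single (p₁, p₂), hg.2.1 _ e₁, hh.2.1 _ e₂]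
      · intro x hx hne
        rw [Finset.HasAntidiagonal.mem_antidiagonal] at hx
        have e : s * (p : ℝ) = s * x.1 + s * x.2 := by rw [← hx]; push_cast; ring
        rcases lt_trichotomy (s * (x.1 : ℝ)) b with h1 | h1 | h1
        · rw [hh.1 x.2 (by linarith), mul_zero]
        · exfalso
          have : x.1 = p₁ := by
            have : s * (x.1 : ℝ) = s * p₁ := by rw [h1, e₁]
            exact_mod_cast mul_left_cancel₀ hs this
          exact hne (Prod.ext this (by simp only; omega))
        · rw [hg.1 _ h1, zero_mul]
      · intro hn
        exact absurd (Finset.HasAntidiagonal.mem_antidiagonal.2 hp') hn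
    · have hl : l * l' = 0 := by
        by_contra hne
        obtain ⟨p₁, e₁⟩ := hg.2.2 (left_ne_zero_of_mul hne)
        obtain ⟨p₂, e₂⟩ := hh.2.2 (right_ne_zero_of_mul hne)
        exact hex ⟨p₁, p₂, e₁, e₂⟩
      rw [hl]
      refine Finset.sum_eq_zero fun x hx => ?_
      rw [Finset.HasAntidiagonal.mem_antidiagonal] at hx
      have e : s * (p : ℝ) = s * x.1 + s * x.2 := by rw [← hx]; push_cast; ring
      rcases lt_trichotomy (s * (x.1 : ℝ)) b with h1 | h1 | h1
      · rw [hh.1 x.2 (by linarith), mul_zero]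
      · exact absurd ⟨x.1, x.2, h1, by linarith⟩ hex
      · rw [hg.1 _ h1, zero_mul]
  · obtain ⟨p₁, e₁⟩ := hg.2.2 (left_ne_zero_of_mul hne)
    obtain ⟨p₂, e₂⟩ := hh.2.2 (right_ne_zero_of_mul hne)
    exact ⟨p₁ + p₂, by push_cast; rw [mul_add, e₁, e₂]⟩

lemma prod (hs : s ≠ 0) {ι : Type*} (t : Finset ι) (G : ι → Polynomial ℂ) (B : ι → ℝ) (L : ι → ℂ)
    (H : ∀ i ∈ t, IsLead s (B i) (G i) (L i)) :
    IsLead s (∑ i ∈ t, B i) (∏ i ∈ t, G i) (∏ i ∈ t, L i) := by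
  classical
  induction t using Finset.induction_on with
  | empty => simpa using one hs
  | insert i t hi ih =>
    rw [Finset.sum_insert hi, Finset.prod_insert hi, Finset.prod_insert hi]
    exact (H i (by simp)).mul hs (ih fun j hj => H j (by simp [hj]))

lemma det (hs : s ≠ 0) {ι : Type*} [Fintype ι] [DecidableEq ι] (A : Matrix ι ι (Polynomial ℂ))
    (U W : ι → ℝ) (L : Matrix ι ι ℂ) (H : ∀ i j, IsLead s (U j - W i) (A i j) (L i j)) :
    IsLead s (∑ j, U j - ∑ i, W i) A.det L.det := by
  rw [Matrix.det_apply', Matrix.det_apply']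
  refine sum _ _ _ fun σ _ => ?_
  have h1 := prod hs Finset.univ (fun i => A (σ i) i) (fun i => U i - W (σ i))
    (fun i => L (σ i) i) (fun i _ => H _ _)
  rw [Finset.sum_sub_distrib, Equiv.sum_comp σ W] at h1
  simpa using h1.C_mul ((Equiv.Perm.sign σ : ℤ) : ℂ)

end IsLead

/-- The number of shifts (up to an offset) applied in a row of the matrix `syl`. -/
def sylShift {N : ℕ} : Fin N ⊕ Fin N → ℕ := Sum.elim (fun t => t + 1) (fun t => t)

/-- The (positive) degree attached to a column of the matrix `syl`. -/
def sylCol {N : ℕ} : Fin N ⊕ Fin N → ℕ := Sum.elim (fun t => t + 1) (fun t => N + 1 + t)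

/-- The weight multiplying the `i`-th coefficient in a row of the matrix `syl`. -/
def sylWt {N : ℕ} : Fin N ⊕ Fin N → ℕ → ℕ := Sum.elim (fun _ i => N + 1 - i) (fun _ i => i)

/-- The Sylvester matrix of `(N + 1) F - y F'` and `F'` for `F = ∑ i ≤ N + 1, c i * y ^ i`;
its determinant is a multiple of the discriminant of `F`. -/
def syl {R : Type*} [CommRing R] (N : ℕ) (c : ℕ → R) : Matrix (Fin N ⊕ Fin N) (Fin N ⊕ Fin N) R :=
  Matrix.of fun ρ κ => if sylShift ρ ≤ sylCol κ ∧ sylCol κ - sylShift ρ ≤ N + 1 then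
    (sylWt ρ (sylCol κ - sylShift ρ) : R) * c (sylCol κ - sylShift ρ) else 0

lemma exists_sylCol {N K : ℕ} (h1 : 1 ≤ K) (h2 : K ≤ 2 * N) :
    ∃ κ : Fin N ⊕ Fin N, sylCol κ = K := by
  by_cases h : K ≤ N
  · exact ⟨Sum.inl ⟨K - 1, by omega⟩, by simp [sylCol]; omega⟩
  · exact ⟨Sum.inr ⟨K - N - 1, by omega⟩, by simp [sylCol]; omega⟩

lemma sylShift_le {N : ℕ} (ρ : Fin N ⊕ Fin N) : sylShift ρ ≤ N := by
  rcases ρ with t | t <;> simp [sylShift]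

lemma sum_sylCol {N : ℕ} {M : Type*} [AddCommMonoid M] (g : ℕ → M) :
    ∑ κ : Fin N ⊕ Fin N, g (sylCol κ) = ∑ K ∈ Finset.range (2 * N), g (K + 1) := by
  rw [Fintype.sum_sum_type, two_mul, Finset.sum_range_add, Finset.sum_range, Finset.sum_range]
  congr 1
  refine Finset.sum_congr rfl fun t _ => ?_
  simp only [sylCol, Sum.elim_inr]
  congr 1; omega

lemma sum_sylShift {N : ℕ} (g : ℕ → ℝ) :
    ∑ ρ : Fin N ⊕ Fin N, g (sylShift ρ) =
      ∑ j ∈ Finset.range N, g (j + 1) + ∑ j ∈ Finset.range N, g j := by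
  rw [Fintype.sum_sum_type, Finset.sum_range, Finset.sum_range]
  rfl

/-- The coefficients of the leading terms of the matrix `syl` with respect to the weights
`midSum r` on columns and `r` on rows. -/
def sylLead {S R : Type*} [Fintype S] [CommRing R] (N : ℕ) (px iy : S → ℕ) (s : ℝ) (r : ℕ → ℝ)
    (a : S → R) : Matrix (Fin N ⊕ Fin N) (Fin N ⊕ Fin N) R :=
  open Classical in
  Matrix.of fun ρ κ => if sylShift ρ ≤ sylCol κ ∧ sylCol κ - sylShift ρ ≤ N + 1 then
    (sylWt ρ (sylCol κ - sylShift ρ) : R) *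
      ∑ k with iy k = sylCol κ - sylShift ρ ∧
        s * px k = midSum r (sylCol κ) - r (sylShift ρ), a k else 0

/-- The coefficient of `y ^ i` in `∑ k, a k * x ^ px k * y ^ iy k`. -/
def rowPoly {S : Type*} [Fintype S] (px iy : S → ℕ) (a : S → ℂ) (i : ℕ) : Polynomial ℂ :=
  ∑ k with iy k = i, Polynomial.C (a k) * Polynomial.X ^ px k

lemma isLead_monomial {s b : ℝ} (hs : s ≠ 0) {p : ℕ} (a : ℂ) (hp : s * p ≤ b)
    [Decidable (s * p = b)] :
    IsLead s b (Polynomial.C a * Polynomial.X ^ p) (if s * p = b then a else 0) := by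
  refine ⟨fun q hq => ?_, fun q hq => ?_, fun hne => ?_⟩
  · rw [Polynomial.coeff_C_mul_X_pow, if_neg]
    rintro rfl
    exact absurd hq (not_lt.2 hp)
  · rw [Polynomial.coeff_C_mul_X_pow]
    have : q = p ↔ s * p = b := by
      rw [← hq, mul_right_inj' hs, eq_comm]; exact_mod_cast Iff.rfl
    simp only [this]
  · split_ifs at hne with h
    · exact ⟨p, h⟩
    · exact absurd rfl hne

lemma isLead_det_syl {S : Type*} [Fintype S] {N : ℕ} {px iy : S → ℕ} {s : ℝ} (hs : s ≠ 0)
    {r : ℕ → ℝ} (hr : DiscreteConcave (N + 1) r) (hle : ∀ k, s * px k ≤ r (iy k)) (a : S → ℂ) :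
    IsLead s (∑ j ∈ Finset.range (N + 1), (r j + r (j + 1)) - r 0 - r (N + 1))
      (syl N (rowPoly px iy a)).det (sylLead N px iy s r a).det := by
  classical
  have := IsLead.det hs (syl N (rowPoly px iy a)) (fun κ => midSum r (sylCol κ))
    (fun ρ => r (sylShift ρ)) (sylLead N px iy s r a) ?_
  · rw [sum_sylCol, sum_sylShift, ← sub_sub, sum_midSum] at this
    exact this
  · intro ρ κ
    simp only [syl, sylLead, Matrix.of_apply]
    split_ifs with h
    · have e : ((sylWt ρ (sylCol κ - sylShift ρ) : ℕ) : Polynomial ℂ) =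
        Polynomial.C ((sylWt ρ (sylCol κ - sylShift ρ) : ℕ) : ℂ) := by simp
      rw [e]
      refine IsLead.C_mul _ ?_
      unfold rowPoly
      have e2 : ∑ k with iy k = sylCol κ - sylShift ρ ∧
          s * px k = midSum r (sylCol κ) - r (sylShift ρ), a k =
          ∑ k with iy k = sylCol κ - sylShift ρ,
            if s * px k = midSum r (sylCol κ) - r (sylShift ρ) then a k else 0 := by
        rw [← Finset.filter_filter, Finset.sum_filter]
      rw [show (∑ k with iy k = sylCol κ - sylShift ρ ∧
          s * px k = midSum r (sylCol κ) - r (sylShift ρ), a k) = _ from e2]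
      refine IsLead.sum _ _ _ fun k hk => ?_
      refine isLead_monomial hs _ ?_
      have hk' : iy k = sylCol κ - sylShift ρ := by simpa using hk
      have h1 := hr.add_le_midSum (i := iy k) (j := sylShift ρ) (by omega)
        (by have := sylShift_le ρ; omega)
      have h2 : iy k + sylShift ρ = sylCol κ := by omega
      rw [h2] at h1
      linarith [hle k]
    · exact IsLead.zero _ _

/-- The coefficient tuple which is `1` at the break points of `r` and `0` elsewhere. -/
def breakCoeff {S : Type*} (N : ℕ) (px iy : S → ℕ) (s : ℝ) (r : ℕ → ℝ) (k : S) : ℂ :=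
  open Classical in if IsBreak (N + 1) r (iy k) ∧ s * px k = r (iy k) then 1 else 0

lemma det_sylLead_breakCoeff_ne_zero {S : Type*} [Fintype S] {N : ℕ} {px iy : S → ℕ} {s : ℝ}
    (hs : s ≠ 0) (hinj : Function.Injective fun k => (px k, iy k))
    {r : ℕ → ℝ} (hr : DiscreteConcave (N + 1) r)
    (hbr : ∀ i ≤ N + 1, IsBreak (N + 1) r i → ∃ k, iy k = i ∧ s * px k = r i) :
    (sylLead N px iy s r (breakCoeff N px iy s r)).det ≠ 0 := by
  classical
  set L := sylLead N px iy s r (breakCoeff N px iy s r) with hL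
  have hsum : ∀ i ≤ N + 1, ∀ b : ℝ, (∑ k with iy k = i ∧ s * px k = b,
      breakCoeff N px iy s r k) = if IsBreak (N + 1) r i ∧ r i = b then 1 else 0 := by
    intro i hi b
    split_ifs with h
    · obtain ⟨hb, rfl⟩ := h
      obtain ⟨k, hk1, hk2⟩ := hbr i hi hb
      rw [Finset.sum_eq_single k]
      · simp [breakCoeff, hk1, hb, hk2]
      · intro k' hk' hne
        exfalso
        simp only [Finset.mem_filter, Finset.mem_univ, true_and] at hk'
        refine hne (hinj (Prod.ext ?_ (hk'.1.trans hk1.symm)))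
        have := hk'.2.trans hk2.symm
        exact_mod_cast mul_left_cancel₀ hs this
      · intro hn
        simp [hk1, hk2] at hn
    · refine Finset.sum_eq_zero fun k hk => ?_
      simp only [Finset.mem_filter, Finset.mem_univ, true_and] at hk
      simp only [breakCoeff, hk.1, hk.2, ite_eq_right_iff]
      rintro ⟨h1, h2⟩
      exact absurd ⟨h1, h2.symm⟩ h
  have hentry : ∀ ρ κ, L ρ κ = if sylShift ρ ≤ sylCol κ ∧ sylCol κ - sylShift ρ ≤ N + 1 ∧
      IsBreak (N + 1) r (sylCol κ - sylShift ρ) ∧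
      r (sylCol κ - sylShift ρ) + r (sylShift ρ) = midSum r (sylCol κ) then
        (sylWt ρ (sylCol κ - sylShift ρ) : ℂ) else 0 := by
    intro ρ κ
    rw [hL]
    simp only [sylLead, Matrix.of_apply]
    by_cases h : sylShift ρ ≤ sylCol κ ∧ sylCol κ - sylShift ρ ≤ N + 1
    · rw [if_pos h]
      have e := hsum _ h.2 (midSum r (sylCol κ) - r (sylShift ρ))
      rw [show (∑ k with iy k = sylCol κ - sylShift ρ ∧
          s * px k = midSum r (sylCol κ) - r (sylShift ρ), breakCoeff N px iy s r k) = _ from e]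
      simp only [eq_sub_iff_add_eq, h.1, h.2, true_and]
      split_ifs <;> simp
    · rw [if_neg h, if_neg]
      tauto
  intro hdet
  obtain ⟨w, hw, hwL⟩ := Matrix.exists_vecMul_eq_zero_iff.2 hdet
  apply hw
  have key : ∀ d, ∀ ρ : Fin N ⊕ Fin N, N - sylShift ρ = d → w ρ = 0 := by
    intro d
    induction d using Nat.strong_induction_on with
    | _ d ih =>
    intro ρ₀ hρ₀
    set j := sylShift ρ₀ with hj
    have hjN : j ≤ N := sylShift_le ρ₀
    have habove : ∀ ρ : Fin N ⊕ Fin N, j < sylShift ρ → w ρ = 0 := fun ρ hρ =>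
      ih (N - sylShift ρ) (by have := sylShift_le ρ; omega) ρ rfl
    obtain ⟨a, ⟨haj, hab⟩, hamax⟩ : ∃ a, (a ≤ j ∧ IsBreak (N + 1) r a) ∧
        ∀ m, a < m → m ≤ j → ¬ IsBreak (N + 1) r m := by
      have hex : ∃ a, a ≤ j ∧ IsBreak (N + 1) r a := ⟨0, by omega, Or.inl rfl⟩
      have h0 : IsBreak (N + 1) r (Nat.findGreatest (IsBreak (N + 1) r) j) :=
        Nat.findGreatest_spec (P := IsBreak (N + 1) r) (Nat.zero_le j) (Or.inl rfl)
      exact ⟨_, ⟨Nat.findGreatest_le j, h0⟩, fun m h1 h2 => Nat.findGreatest_is_greatest h1 h2⟩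
    obtain ⟨b, ⟨hjb, hbb⟩, hbmin⟩ : ∃ b, (j < b ∧ IsBreak (N + 1) r b) ∧
        ∀ m, m < b → ¬ (j < m ∧ IsBreak (N + 1) r m) := by
      have hex : ∃ b, j < b ∧ IsBreak (N + 1) r b := ⟨N + 1, by omega, Or.inr (Or.inl rfl)⟩
      exact ⟨Nat.find hex, Nat.find_spec hex, fun m => Nat.find_min hex⟩
    have hbN : b ≤ N + 1 := by
      by_contra hcon
      exact hbmin (N + 1) (by omega) ⟨by omega, Or.inr (Or.inl rfl)⟩
    have eqn : ∀ e : ℕ, e ≤ N + 1 → IsBreak (N + 1) r e → r e + r j = midSum r (e + j) →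
        1 ≤ e + j → e + j ≤ 2 * N →
        (∀ i j', IsBreak (N + 1) r i → i + j' = e + j → i ≤ N + 1 → j' < j →
          r i + r j' < midSum r (i + j')) →
        ∑ ρ with sylShift ρ = j, w ρ * (sylWt ρ e : ℂ) = 0 := by
      intro e heN heb he h1 h2 hlt
      obtain ⟨κ, hκ⟩ := exists_sylCol (N := N) h1 h2
      have h3 := congrFun hwL κ
      simp only [Matrix.vecMul, dotProduct, Pi.zero_apply] at h3
      rw [← h3, Finset.sum_filter]
      refine Finset.sum_congr rfl fun ρ _ => ?_
      rw [hentry, hκ]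
      split_ifs with hρ hc hc
      · rw [hρ, Nat.add_sub_cancel]
      · exfalso
        apply hc
        rw [hρ, Nat.add_sub_cancel]
        exact ⟨by omega, heN, heb, he⟩
      · rcases lt_or_gt_of_ne hρ with hlt' | hgt
        · have h4 := hlt (e + j - sylShift ρ) (sylShift ρ) hc.2.2.1 (by omega) hc.2.1 hlt'
          rw [hc.2.2.2] at h4
          rw [show e + j - sylShift ρ + sylShift ρ = e + j by omega] at h4
          exact absurd h4 (lt_irrefl _)
        · rw [habove ρ hgt, zero_mul]
      · simp
    set P : ℂ := ∑ t : Fin N, if (t : ℕ) + 1 = j then w (Sum.inl t) else 0 with hP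
    set Q : ℂ := ∑ t : Fin N, if (t : ℕ) = j then w (Sum.inr t) else 0 with hQ
    have hsplit : ∀ e : ℕ, ∑ ρ with sylShift ρ = j, w ρ * (sylWt ρ e : ℂ) =
        ((N + 1 - e : ℕ) : ℂ) * P + e * Q := by
      intro e
      rw [Finset.sum_filter, Fintype.sum_sum_type, hP, hQ, Finset.mul_sum, Finset.mul_sum]
      congr 1 <;> refine Finset.sum_congr rfl fun t _ => ?_
      · by_cases h : (t : ℕ) + 1 = j <;> simp [sylShift, sylWt, h, mul_comm]
      · by_cases h : (t : ℕ) = j <;> simp [sylShift, sylWt, h, mul_comm]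
    have e1 : ((N + 1 - a : ℕ) : ℂ) * P + a * Q = 0 := by
      by_cases h0 : a + j = 0
      · have ha : a = 0 := by omega
        have hj0 : j = 0 := by omega
        have : P = 0 := Finset.sum_eq_zero fun t _ => by rw [if_neg (by omega)]
        rw [this, ha]; simp
      · rw [← hsplit]
        refine eqn a (by omega) hab (hr.add_eq_midSum haj (by omega) fun m h1 h2 =>
          hamax m h1 h2.le) (by omega) (by omega) fun i j' hi hij hiN hj' => ?_
        rw [add_comm (r i), add_comm i]
        refine hr.add_lt_midSum (m := a) ?_ (by omega) hiN hab
        have hbi : b ≤ i := by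
          by_contra hcon
          by_cases hij' : i ≤ j
          · exact hamax i (by omega) hij' hi
          · exact hbmin i (by omega) ⟨by omega, hi⟩
        omega
    have e2 : ((N + 1 - b : ℕ) : ℂ) * P + b * Q = 0 := by
      by_cases h0 : b + j = 2 * N + 1
      · have hb : b = N + 1 := by omega
        have hj0 : j = N := by omega
        have : Q = 0 := Finset.sum_eq_zero fun t _ => by rw [if_neg (by omega)]
        rw [this, hb]; simp
      · rw [← hsplit]
        refine eqn b (by omega) hbb ?_ (by omega) (by omega) fun i j' hi hij hiN hj' => ?_
        · rw [add_comm (r b), add_comm b]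
          exact hr.add_eq_midSum hjb.le hbN fun m h1 h2 hm => hbmin m h2 ⟨h1, hm⟩
        · rw [add_comm (r i), add_comm i]
          exact hr.add_lt_midSum (m := b) (by omega) (by omega) hiN hbb
    have hba : ((b : ℂ) - a) ≠ 0 := by
      rw [sub_ne_zero]; exact_mod_cast (by omega : b ≠ a)
    have hN1 : ((N : ℂ) + 1) ≠ 0 := by exact_mod_cast Nat.succ_ne_zero N
    rw [Nat.cast_sub (by omega)] at e1 e2
    push_cast at e1 e2
    have hP0 : P = 0 := by
      have : ((N : ℂ) + 1) * (b - a) * P = 0 := by linear_combination b * e1 - a * e2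
      simpa [hN1, hba] using this
    have hQ0 : Q = 0 := by
      have : ((N : ℂ) + 1) * (b - a) * Q = 0 := by
        linear_combination (N + 1 - a) * e2 - (N + 1 - b) * e1
      simpa [hN1, hba] using this
    rcases ρ₀ with t | t
    · simp only [sylShift, Sum.elim_inl] at hj
      rw [hP, Finset.sum_eq_single t] at hP0
      · simpa [hj] using hP0
      · intro t' _ hne
        rw [if_neg]
        intro h
        exact hne (Fin.ext (by omega))
      · simp
    · simp only [sylShift, Sum.elim_inr] at hj
      rw [hQ, Finset.sum_eq_single t] at hQ0
      · simpa [hj] using hQ0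
      · intro t' _ hne
        rw [if_neg]
        intro h
        exact hne (Fin.ext (by omega))
      · simp
  funext ρ
  exact key _ ρ rfl

/-- Nonvanishing of the extreme coefficient of `det (syl N (rowPoly px iy a))` is a generic
condition on `a`. -/
lemma exists_generic_lead {S : Type*} [Fintype S] {N : ℕ} {px iy : S → ℕ} {s : ℝ}
    (hs : s ≠ 0) (hinj : Function.Injective fun k => (px k, iy k))
    {r : ℕ → ℝ} (hr : DiscreteConcave (N + 1) r) (hle : ∀ k, s * px k ≤ r (iy k))
    (hbr : ∀ i ≤ N + 1, IsBreak (N + 1) r i → ∃ k, iy k = i ∧ s * px k = r i) :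
    ∃ D : MvPolynomial S ℂ, D ≠ 0 ∧ ∀ a : S → ℂ, eval a D ≠ 0 →
      ∃ l : ℂ, l ≠ 0 ∧
        IsLead s (∑ j ∈ Finset.range (N + 1), (r j + r (j + 1)) - r 0 - r (N + 1))
          (syl N (rowPoly px iy a)).det l := by
  have hev : ∀ a : S → ℂ, eval a (sylLead N px iy s r (X : S → MvPolynomial S ℂ)).det =
      (sylLead N px iy s r a).det := by
    intro a
    rw [RingHom.map_det]
    congr 1
    ext ρ κ
    simp only [sylLead, RingHom.mapMatrix_apply, Matrix.map_apply, Matrix.of_apply]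
    split_ifs <;> simp
  refine ⟨(sylLead N px iy s r (X : S → MvPolynomial S ℂ)).det, ?_, fun a ha => ?_⟩
  · intro h0
    have := hev (breakCoeff N px iy s r)
    rw [h0, map_zero] at this
    exact det_sylLead_breakCoeff_ne_zero hs hinj hr hbr this.symm
  · rw [hev] at ha
    exact ⟨_, ha, isLead_det_syl hs hr hle a⟩

/-- A tuple `a` annihilated by some specialisation of a matrix with `m` rows depending on `q < m`
parameters, whose minor with columns `e` does not vanish at that specialisation, lies on a proper
hypersurface. -/
lemma exists_generic_avoid {S : Type*} [Fintype S] {q m : ℕ} (hqm : q < m)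
    (L : Matrix (Fin m) S (MvPolynomial (Fin q) ℂ)) (e : Fin m → S) (he : Function.Injective e) :
    ∃ D : MvPolynomial S ℂ, D ≠ 0 ∧ ∀ (a : S → ℂ) (t : Fin q → ℂ),
      eval t (L.submatrix id e).det ≠ 0 → (∀ ρ, ∑ k, eval t (L ρ k) * a k = 0) →
      eval a D = 0 := by
  classical
  set M := L.submatrix id e with hM
  let ι : MvPolynomial (Fin q) ℂ →ₐ[ℂ] MvPolynomial (Fin q ⊕ {k // k ∉ Set.range e}) ℂ :=
    rename Sum.inl
  let z : S → MvPolynomial (Fin q ⊕ {k // k ∉ Set.range e}) ℂ :=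
    fun k => if h : k ∈ Set.range e then 0 else X (Sum.inr ⟨k, h⟩)
  let φ : S → MvPolynomial (Fin q ⊕ {k // k ∉ Set.range e}) ℂ :=
    fun k => ι M.det * z k - ∑ ρ, if e ρ = k then
      ∑ j, ι (M.adjugate ρ j) * ∑ k', ι (L j k') * z k' else 0
  have hnot : ¬ AlgebraicIndependent ℂ φ := by
    intro hind
    have h1 := hind.lift_cardinalMk_le_trdeg
    rw [MvPolynomial.trdeg_of_isDomain] at h1
    simp only [Cardinal.mk_fintype, Cardinal.lift_natCast, Nat.cast_le] at h1
    rw [Fintype.card_sum, Fintype.card_fin, Fintype.card_subtype_compl] at h1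
    have h2 : Fintype.card (Set.range e) = m := by
      rw [Set.card_range_of_injective he, Fintype.card_fin]
    have h3 : m ≤ Fintype.card S := by
      simpa using Fintype.card_le_of_injective e he
    have h4 : Fintype.card {x // x ∈ Set.range e} = m := h2
    omega
  rw [algebraicIndependent_iff] at hnot
  push Not at hnot
  obtain ⟨D, hD0, hD⟩ := hnot
  refine ⟨D, hD, fun a t ht ha => ?_⟩
  set δ := eval t M.det with hδ
  let p : Fin q ⊕ {k // k ∉ Set.range e} → ℂ := Sum.elim t fun k => a k / δ
  have hι : ∀ g, eval p (ι g) = eval t g := fun g => by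
    simp only [ι, eval_rename]; rfl
  have hz : ∀ k, eval p (z k) = if k ∈ Set.range e then 0 else a k / δ := by
    intro k
    by_cases h : k ∈ Set.range e
    · simp only [z, dif_pos h, if_pos h, map_zero]
    · simp only [z, dif_neg h, if_neg h, eval_X, p, Sum.elim_inr]
  have hrow : ∀ j, ∑ k', eval t (L j k') * (if k' ∈ Set.range e then 0 else a k' / δ) =
      -(∑ ρ, eval t (M j ρ) * a (e ρ)) / δ := by
    intro j
    have h1 := ha j
    have h2 : ∑ k, (if k ∈ Set.range e then eval t (L j k) * a k else 0) =
        ∑ ρ, eval t (M j ρ) * a (e ρ) := by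
      rw [← Finset.sum_filter]
      have : Finset.univ.filter (fun k => k ∈ Set.range e) = Finset.univ.image e := by
        ext k; simp
      rw [this, Finset.sum_image (fun x _ y _ h => he h)]
      rfl
    rw [← h2, eq_div_iff ht, Finset.sum_mul, eq_neg_iff_add_eq_zero, ← Finset.sum_add_distrib]
    refine Eq.trans (Finset.sum_congr rfl fun k _ => ?_) h1
    split_ifs
    · simp
    · field_simp
      simp
  have hφ : ∀ k, eval p (φ k) = a k := by
    intro k
    simp only [φ, map_sub, map_mul, map_sum, apply_ite (eval p), map_zero, hι, hz]
    by_cases hk : k ∈ Set.range e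
    · obtain ⟨ρ, rfl⟩ := hk
      rw [if_pos ⟨ρ, rfl⟩, Finset.sum_eq_single ρ, if_pos rfl]
      · have h1 : ∀ j, eval t (M.adjugate ρ j) * ∑ k', eval t (L j k') *
            (if k' ∈ Set.range e then 0 else a k' / δ) =
            -(∑ ρ', eval t (M.adjugate ρ j * M j ρ') * a (e ρ')) / δ := by
          intro j
          rw [hrow, mul_div_assoc', mul_neg, Finset.mul_sum]
          simp only [map_mul, mul_assoc]
        simp only [h1]
        rw [← Finset.sum_div, Finset.sum_neg_distrib, Finset.sum_comm]
        have h2 : ∀ ρ', ∑ j, eval t (M.adjugate ρ j * M j ρ') * a (e ρ') =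
            (if ρ = ρ' then δ else 0) * a (e ρ') := by
          intro ρ'
          rw [← Finset.sum_mul, ← map_sum, ← Matrix.mul_apply, Matrix.adjugate_mul,
            Matrix.smul_apply, Matrix.one_apply]
          split_ifs <;> simp [hδ]
        simp only [h2]
        rw [Finset.sum_eq_single ρ]
        · rw [if_pos rfl]; field_simp; ring
        · intro b _ hb
          rw [if_neg (Ne.symm hb), zero_mul]
        · simp
      · intro b _ hb
        rw [if_neg fun h => hb (he h)]
      · simp
    · rw [if_neg hk, Finset.sum_eq_zero]
      · rw [sub_zero, ← hδ]; field_simp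
      · intro ρ _
        rw [if_neg fun h => hk ⟨ρ, h⟩]
  have h := congrArg (eval p) hD0
  rw [map_zero, aeval_def, eval₂_eq'] at h
  rw [eval_eq', ← h]
  simp [map_sum, hφ]

section Sylvester

open Polynomial

/-- The polynomial of degree at most `N + 1` with coefficients `c`. -/
def coeffPoly {R : Type*} [CommRing R] (N : ℕ) (c : ℕ → R) : R[X] :=
  ∑ i ∈ Finset.range (N + 2), Polynomial.C (c i) * Polynomial.X ^ i

/-- The combination `(N + 1) F - y F'` for `F = coeffPoly N c`. -/
def eulerPoly {R : Type*} [CommRing R] (N : ℕ) (c : ℕ → R) : R[X] :=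
  ((N + 1 : ℕ) : R[X]) * coeffPoly N c - Polynomial.X * derivative (coeffPoly N c)

variable {N : ℕ}

lemma coeff_coeffPoly {R : Type*} [CommRing R] (c : ℕ → R) (j : ℕ) :
    (coeffPoly N c).coeff j = if j < N + 2 then c j else 0 := by
  simp [coeffPoly, Polynomial.finsetSum_coeff, Polynomial.coeff_C_mul, Polynomial.coeff_X_pow]

lemma coeff_eulerPoly {R : Type*} [CommRing R] (c : ℕ → R) (j : ℕ) :
    (eulerPoly N c).coeff j = if j < N + 1 then ((N + 1 - j : ℕ) : R) * c j else 0 := by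
  have h : (Polynomial.X * derivative (coeffPoly N c)).coeff j =
      j * (coeffPoly N c).coeff j := by
    cases j with
    | zero => simp
    | succ j => rw [Polynomial.coeff_X_mul, Polynomial.coeff_derivative]; push_cast; ring
  rw [eulerPoly, Polynomial.coeff_sub, h, Polynomial.coeff_natCast_mul, coeff_coeffPoly]
  by_cases h1 : j < N + 1
  · rw [if_pos (by omega), if_pos h1, Nat.cast_sub (by omega)]; ring
  · rw [if_neg h1]
    split_ifs with h2
    · have : j = N + 1 := by omega
      subst this; ring
    · ring

lemma coeff_derivative_coeffPoly {R : Type*} [CommRing R] (c : ℕ → R) (j : ℕ) :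
    (derivative (coeffPoly N c)).coeff j =
      if j < N + 1 then ((j + 1 : ℕ) : R) * c (j + 1) else 0 := by
  rw [Polynomial.coeff_derivative, coeff_coeffPoly]
  by_cases h : j < N + 1
  · rw [if_pos (by omega), if_pos h]; push_cast; ring
  · rw [if_neg (by omega), if_neg h, zero_mul]

lemma natDegree_eulerPoly_le {R : Type*} [CommRing R] (c : ℕ → R) :
    (eulerPoly N c).natDegree ≤ N := by
  refine Polynomial.natDegree_le_iff_coeff_eq_zero.2 fun j hj => ?_
  rw [coeff_eulerPoly, if_neg (by omega)]

lemma natDegree_derivative_coeffPoly_le {R : Type*} [CommRing R] (c : ℕ → R) :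
    (derivative (coeffPoly N c)).natDegree ≤ N := by
  refine Polynomial.natDegree_le_iff_coeff_eq_zero.2 fun j hj => ?_
  rw [coeff_derivative_coeffPoly, if_neg (by omega)]

lemma sum_shifted_coeff_mul_pow {R : Type*} [CommRing R] {g : R[X]} (hg : g.natDegree ≤ N)
    {t : ℕ} (ht : t < N) (y : R) :
    ∑ K ∈ Finset.range (2 * N), (if t ≤ K ∧ K - t ≤ N then g.coeff (K - t) else 0) * y ^ K =
      y ^ t * g.eval y := by
  rw [Polynomial.eval_eq_sum_range' (n := N + 1) (by omega), Finset.mul_sum]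
  simp only [ite_mul, zero_mul]
  rw [← Finset.sum_filter]
  refine Finset.sum_nbij' (fun K => K - t) (fun i => i + t) ?_ ?_ ?_ ?_ ?_
  · intro K hK; simp only [Finset.mem_filter, Finset.mem_range] at hK ⊢; omega
  · intro i hi; simp only [Finset.mem_filter, Finset.mem_range] at hi ⊢; omega
  · intro K hK; simp only [Finset.mem_filter, Finset.mem_range] at hK ⊢; omega
  · intro i hi; simp
  · intro K hK
    simp only [Finset.mem_filter, Finset.mem_range] at hK
    rw [show y ^ K = y ^ (K - t) * y ^ t by rw [← pow_add]; congr 1; omega]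
    ring

lemma sum_syl_inl_mul_pow {R : Type*} [CommRing R] (c : ℕ → R) (y : R) (t : Fin N) :
    ∑ κ, syl N c (Sum.inl t) κ * y ^ (sylCol κ - 1) = y ^ (t : ℕ) * (eulerPoly N c).eval y := by
  rw [← sum_shifted_coeff_mul_pow (natDegree_eulerPoly_le c) t.2]
  simp only [syl, Matrix.of_apply]
  rw [sum_sylCol (fun K => (if sylShift (Sum.inl t) ≤ K ∧ K - sylShift (Sum.inl t) ≤ N + 1 then
    (sylWt (Sum.inl t) (K - sylShift (Sum.inl t)) : R) * c (K - sylShift (Sum.inl t)) else 0) *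
      y ^ (K - 1))]
  refine Finset.sum_congr rfl fun K _ => ?_
  simp only [sylShift, sylWt, Sum.elim_inl, Nat.add_sub_add_right, Nat.add_sub_cancel,
    add_le_add_iff_right, coeff_eulerPoly]
  congr 1
  by_cases h : (t : ℕ) ≤ K <;> simp only [h, true_and, false_and, if_false]
  rcases lt_trichotomy (K - t) (N + 1) with h1 | h1 | h1
  · rw [if_pos h1.le, if_pos (by omega), if_pos h1]
  · rw [if_pos h1.le, if_neg (by omega), h1]; simp
  · rw [if_neg (by omega), if_neg (by omega)]

lemma sum_syl_inr_mul_pow {R : Type*} [CommRing R] (c : ℕ → R) (y : R) (t : Fin N) :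
    ∑ κ, syl N c (Sum.inr t) κ * y ^ (sylCol κ - 1) =
      y ^ (t : ℕ) * (derivative (coeffPoly N c)).eval y := by
  rw [← sum_shifted_coeff_mul_pow (natDegree_derivative_coeffPoly_le c) t.2]
  simp only [syl, Matrix.of_apply]
  rw [sum_sylCol (fun K => (if sylShift (Sum.inr t) ≤ K ∧ K - sylShift (Sum.inr t) ≤ N + 1 then
    (sylWt (Sum.inr t) (K - sylShift (Sum.inr t)) : R) * c (K - sylShift (Sum.inr t)) else 0) *
      y ^ (K - 1))]
  refine Finset.sum_congr rfl fun K _ => ?_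
  simp only [sylShift, sylWt, Sum.elim_inr, Nat.add_sub_cancel, coeff_derivative_coeffPoly]
  congr 1
  by_cases h : (t : ℕ) ≤ K
  · simp only [h, true_and, show (t : ℕ) ≤ K + 1 by omega, show K + 1 - t = K - t + 1 by omega]
    by_cases h1 : K - t ≤ N
    · rw [if_pos (by omega), if_pos h1, if_pos (by omega)]
    · rw [if_neg (by omega), if_neg h1]
  · rw [if_neg (fun hh => h hh.1)]
    have h1 : K + 1 - t = 0 := by omega
    simp [h1]

/-- The polynomial with coefficient vector `u`. -/
def vecPoly (u : Fin N → ℂ) : ℂ[X] := ∑ t, Polynomial.C (u t) * Polynomial.X ^ (t : ℕ)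

lemma coeff_vecPoly (u : Fin N → ℂ) (t : Fin N) : (vecPoly u).coeff t = u t := by
  simp only [vecPoly, Polynomial.finsetSum_coeff, Polynomial.coeff_C_mul, Polynomial.coeff_X_pow]
  rw [Finset.sum_eq_single t]
  · simp
  · intro b _ hb
    rw [if_neg (fun h => hb (Fin.ext h.symm)), mul_zero]
  · simp

lemma degree_vecPoly_lt (u : Fin N → ℂ) : (vecPoly u).degree < N := by
  refine (Polynomial.degree_lt_iff_coeff_zero _ _).2 fun j hj => ?_
  simp only [vecPoly, Polynomial.finsetSum_coeff, Polynomial.coeff_C_mul, Polynomial.coeff_X_pow]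
  refine Finset.sum_eq_zero fun t _ => ?_
  rw [if_neg (by omega), mul_zero]

lemma sum_mul_syl_mul_pow (c : ℕ → ℂ) (w : Fin N ⊕ Fin N → ℂ) (y : ℂ) :
    ∑ κ, (Matrix.vecMul w (syl N c)) κ * y ^ (sylCol κ - 1) =
      (vecPoly (w ∘ Sum.inl)).eval y * (eulerPoly N c).eval y +
        (vecPoly (w ∘ Sum.inr)).eval y * (derivative (coeffPoly N c)).eval y := by
  simp only [Matrix.vecMul, dotProduct, Finset.sum_mul]
  rw [Finset.sum_comm]
  simp only [mul_assoc, ← Finset.mul_sum]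
  rw [Fintype.sum_sum_type]
  simp only [sum_syl_inl_mul_pow, sum_syl_inr_mul_pow, vecPoly, Polynomial.eval_finsetSum,
    Finset.sum_mul, Function.comp, Polynomial.eval_mul, Polynomial.eval_C, Polynomial.eval_pow,
    Polynomial.eval_X, mul_assoc]

lemma vecPoly_mul_add_eq_zero {c : ℕ → ℂ} {w : Fin N ⊕ Fin N → ℂ}
    (hw : Matrix.vecMul w (syl N c) = 0) :
    vecPoly (w ∘ Sum.inl) * eulerPoly N c +
      vecPoly (w ∘ Sum.inr) * derivative (coeffPoly N c) = 0 := by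
  refine Polynomial.funext fun y => ?_
  rw [Polynomial.eval_add, Polynomial.eval_mul, Polynomial.eval_mul, ← sum_mul_syl_mul_pow, hw]
  simp

lemma eval_eulerPoly (c : ℕ → ℂ) (y : ℂ) : (eulerPoly N c).eval y =
    (N + 1) * (coeffPoly N c).eval y - y * (derivative (coeffPoly N c)).eval y := by
  simp [eulerPoly]

/-- A root of `F = coeffPoly N c` and of its derivative gives a right kernel vector of `syl N c`. -/
lemma syl_mulVec_pow_eq_zero {c : ℕ → ℂ} {y : ℂ} (h1 : (coeffPoly N c).eval y = 0)
    (h2 : (derivative (coeffPoly N c)).eval y = 0) :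
    Matrix.mulVec (syl N c) (fun κ => y ^ (sylCol κ - 1)) = 0 := by
  funext ρ
  rcases ρ with t | t
  · exact (sum_syl_inl_mul_pow c y t).trans (by rw [eval_eulerPoly, h1, h2]; simp)
  · exact (sum_syl_inr_mul_pow c y t).trans (by rw [h2]; simp)

lemma det_syl_eq_zero_of_root (hN : 0 < N) {c : ℕ → ℂ} {y : ℂ} (h1 : (coeffPoly N c).eval y = 0)
    (h2 : (derivative (coeffPoly N c)).eval y = 0) : (syl N c).det = 0 := by
  refine Matrix.exists_mulVec_eq_zero_iff.1 ⟨_, ?_, syl_mulVec_pow_eq_zero h1 h2⟩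
  intro h
  have := congrFun h (Sum.inl ⟨0, hN⟩)
  simp [sylCol] at this

/-- Solutions of `U A + V B = 0` with `A`, `B` coprime and one of them of large degree are constant
multiples of `(B, -A)`. -/
lemma exists_C_mul_of_isCoprime {A B U V : ℂ[X]} {d : ℕ} (hAB : IsCoprime A B)
    (hd : (d : WithBot ℕ) ≤ A.degree ∨ (d : WithBot ℕ) ≤ B.degree) (hU : U.degree < (d + 1 : ℕ))
    (hV : V.degree < (d + 1 : ℕ)) (h : U * A + V * B = 0) :
    ∃ s : ℂ, U = Polynomial.C s * B ∧ V = -(Polynomial.C s * A) := by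
  obtain ⟨p, q, hpq⟩ := hAB
  have hU' : U = (q * U - p * V) * B := by linear_combination U * (-hpq) + p * h
  have hV' : V = -((q * U - p * V) * A) := by linear_combination V * (-hpq) + q * h
  set s := q * U - p * V
  suffices hs : s.degree ≤ 0 by
    rw [Polynomial.degree_le_zero_iff] at hs
    exact ⟨s.coeff 0, by rw [← hs]; exact hU', by rw [← hs]; exact hV'⟩
  by_contra hs
  have h1 : (1 : WithBot ℕ) ≤ s.degree := by
    have h0 : s ≠ 0 := by rintro h0; simp [h0] at hs
    rw [Polynomial.degree_eq_natDegree h0] at hs ⊢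
    exact_mod_cast Nat.one_le_iff_ne_zero.2 fun h => hs (by rw [h]; rfl)
  rcases hd with hd | hd
  · rw [hV', Polynomial.degree_neg, Polynomial.degree_mul] at hV
    refine absurd hV (not_lt.2 ?_)
    calc ((d + 1 : ℕ) : WithBot ℕ) = 1 + d := by rw [add_comm]; push_cast; rfl
      _ ≤ _ := add_le_add h1 hd
  · rw [hU', Polynomial.degree_mul] at hU
    refine absurd hU (not_lt.2 ?_)
    calc ((d + 1 : ℕ) : WithBot ℕ) = 1 + d := by rw [add_comm]; push_cast; rfl
      _ ≤ _ := add_le_add h1 hd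

lemma isCoprime_of_no_common_root {A B : ℂ[X]} (h : ∀ y, A.eval y = 0 → B.eval y ≠ 0) :
    IsCoprime A B := by
  rw [Polynomial.isCoprime_iff_aeval_ne_zero_of_isAlgClosed ℂ ℂ]
  intro y
  simp only [Polynomial.coe_aeval_eq_eval]
  by_contra! hcon
  exact h y hcon.1 hcon.2

lemma le_degree_eulerPoly_or {c : ℕ → ℂ} (htop : c (N + 1) = 0 → c N ≠ 0) :
    (N : WithBot ℕ) ≤ (eulerPoly N c).degree ∨
      (N : WithBot ℕ) ≤ (derivative (coeffPoly N c)).degree := by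
  by_cases h : c (N + 1) = 0
  · left
    refine Polynomial.le_degree_of_ne_zero ?_
    rw [coeff_eulerPoly, if_pos (by omega)]
    simpa using htop h
  · right
    refine Polynomial.le_degree_of_ne_zero ?_
    rw [coeff_derivative_coeffPoly, if_pos (by omega)]
    exact mul_ne_zero (by exact_mod_cast N.succ_ne_zero) h

/-- A common root of `eulerPoly N c` and of the derivative of `F` is a nonzero double root of
`F`. -/
lemma common_root {c : ℕ → ℂ} (hbot : c 0 = 0 → c 1 ≠ 0) {y : ℂ}
    (h1 : (eulerPoly N c).eval y = 0) (h2 : (derivative (coeffPoly N c)).eval y = 0) :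
    y ≠ 0 ∧ (coeffPoly N c).eval y = 0 := by
  rw [eval_eulerPoly, h2, mul_zero, sub_zero] at h1
  have hF : (coeffPoly N c).eval y = 0 :=
    (mul_eq_zero.1 h1).resolve_left (by exact_mod_cast N.succ_ne_zero)
  refine ⟨?_, hF⟩
  rintro rfl
  rw [← Polynomial.coeff_zero_eq_eval_zero] at hF h2
  rw [coeff_coeffPoly, if_pos (by omega)] at hF
  rw [coeff_derivative_coeffPoly, if_pos (by omega)] at h2
  exact hbot hF (by simpa using h2)

lemma vecPoly_eq_zero {u : Fin N → ℂ} (h : vecPoly u = 0) : u = 0 := by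
  funext t
  simp [← coeff_vecPoly u, h]

lemma eq_zero_of_vecPoly {w : Fin N ⊕ Fin N → ℂ} (h1 : vecPoly (w ∘ Sum.inl) = 0)
    (h2 : vecPoly (w ∘ Sum.inr) = 0) : w = 0 := by
  funext ρ
  rcases ρ with t | t
  · exact congrFun (vecPoly_eq_zero h1) t
  · exact congrFun (vecPoly_eq_zero h2) t

lemma exists_root_of_det_syl_eq_zero {c : ℕ → ℂ} (htop : c (N + 1) = 0 → c N ≠ 0)
    (hbot : c 0 = 0 → c 1 ≠ 0) (hdet : (syl N c).det = 0) :
    ∃ y ≠ 0, (coeffPoly N c).eval y = 0 ∧ (derivative (coeffPoly N c)).eval y = 0 := by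
  by_contra! hcon
  have hco : IsCoprime (eulerPoly N c) (derivative (coeffPoly N c)) := by
    refine isCoprime_of_no_common_root fun y h1 h2 => ?_
    obtain ⟨h3, h4⟩ := common_root hbot h1 h2
    exact hcon y h3 h4 h2
  obtain ⟨w, hw0, hw⟩ := Matrix.exists_vecMul_eq_zero_iff.2 hdet
  have hlt : ∀ u : Fin N → ℂ, (vecPoly u).degree < (N + 1 : ℕ) := fun u =>
    (degree_vecPoly_lt u).trans (by exact_mod_cast N.lt_succ_self)
  have hd := le_degree_eulerPoly_or htop
  obtain ⟨s, hU, hV⟩ := exists_C_mul_of_isCoprime hco hd (hlt _) (hlt _)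
    (vecPoly_mul_add_eq_zero hw)
  have hs : s = 0 := by
    by_contra hs
    rcases hd with hd | hd
    · have := degree_vecPoly_lt (w ∘ Sum.inr)
      rw [hV, Polynomial.degree_neg, Polynomial.degree_C_mul hs] at this
      exact absurd this (not_lt.2 hd)
    · have := degree_vecPoly_lt (w ∘ Sum.inl)
      rw [hU, Polynomial.degree_C_mul hs] at this
      exact absurd this (not_lt.2 hd)
  subst hs
  exact hw0 (eq_zero_of_vecPoly (by simpa using hU) (by simpa using hV))

/-- If `F = coeffPoly N c` has a single nonzero double root and this root is not a triple root,
then the left kernel of `syl N c` is spanned by an explicit vector. -/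
lemma exists_kernel_description (hN : 0 < N) {c : ℕ → ℂ} (htop : c (N + 1) = 0 → c N ≠ 0)
    (hbot : c 0 = 0 → c 1 ≠ 0) {y₀ : ℂ} (h1 : (coeffPoly N c).eval y₀ = 0)
    (h2 : (derivative (coeffPoly N c)).eval y₀ = 0)
    (h3 : (derivative (derivative (coeffPoly N c))).eval y₀ ≠ 0)
    (huniq : ∀ y ≠ 0, (coeffPoly N c).eval y = 0 → (derivative (coeffPoly N c)).eval y = 0 →
      y = y₀) :
    ∃ A B : ℂ[X], A.eval y₀ = -(y₀ * (derivative (derivative (coeffPoly N c))).eval y₀) ∧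
      B.eval y₀ = (derivative (derivative (coeffPoly N c))).eval y₀ ∧
      ∀ w, Matrix.vecMul w (syl N c) = 0 → ∃ s : ℂ, vecPoly (w ∘ Sum.inl) = Polynomial.C s * B ∧
        vecPoly (w ∘ Sum.inr) = -(Polynomial.C s * A) := by
  have hA0 : (eulerPoly N c).eval y₀ = 0 := by rw [eval_eulerPoly, h1, h2]; simp
  obtain ⟨A, hA⟩ := Polynomial.dvd_iff_isRoot.2 hA0
  obtain ⟨B, hB⟩ := Polynomial.dvd_iff_isRoot.2 h2
  have hAe : A.eval y₀ = (derivative (eulerPoly N c)).eval y₀ := by rw [hA]; simp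
  have hBe : B.eval y₀ = (derivative (derivative (coeffPoly N c))).eval y₀ := by
    conv_rhs => rw [hB]
    simp
  have hAe' : A.eval y₀ = -(y₀ * (derivative (derivative (coeffPoly N c))).eval y₀) := by
    rw [hAe, eulerPoly]
    simp only [derivative_sub, derivative_mul, derivative_natCast, derivative_X,
      Polynomial.eval_add, Polynomial.eval_sub, Polynomial.eval_mul, Polynomial.eval_X, h2,
      Polynomial.eval_one, Polynomial.eval_zero]
    ring
  refine ⟨A, B, hAe', hBe, fun w hw => ?_⟩
  have hco : IsCoprime A B := by
    refine isCoprime_of_no_common_root fun y e1 e2 => ?_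
    have e3 : (eulerPoly N c).eval y = 0 := by rw [hA]; simp [e1]
    have e4 : (derivative (coeffPoly N c)).eval y = 0 := by rw [hB]; simp [e2]
    obtain ⟨e5, e6⟩ := common_root hbot e3 e4
    have := huniq y e5 e6 e4
    subst this
    exact h3 (hBe.symm.trans e2)
  obtain ⟨d, rfl⟩ : ∃ d, N = d + 1 := ⟨N - 1, by omega⟩
  refine exists_C_mul_of_isCoprime (d := d) hco ?_ (degree_vecPoly_lt _) (degree_vecPoly_lt _) ?_
  · have hle : ∀ {G : ℂ[X]}, ((d + 1 : ℕ) : WithBot ℕ) ≤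
        ((Polynomial.X - Polynomial.C y₀) * G).degree → (d : WithBot ℕ) ≤ G.degree := by
      intro G hG
      have h0 : G ≠ 0 := by rintro rfl; simp at hG
      have hX := Polynomial.X_sub_C_ne_zero y₀
      rw [Polynomial.degree_eq_natDegree (mul_ne_zero hX h0), Polynomial.natDegree_mul hX h0,
        Polynomial.natDegree_X_sub_C, Nat.cast_le] at hG
      rw [Polynomial.degree_eq_natDegree h0, Nat.cast_le]
      omega
    refine (le_degree_eulerPoly_or htop).imp (fun h => hle ?_) (fun h => hle ?_)
    · rwa [← hA]
    · rwa [← hB]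
  · have := vecPoly_mul_add_eq_zero hw
    rw [hA, hB] at this
    have hX : (Polynomial.X - Polynomial.C y₀) ≠ 0 := Polynomial.X_sub_C_ne_zero y₀
    apply (mul_eq_zero.1 (_ : (Polynomial.X - Polynomial.C y₀) * _ = 0)).resolve_left hX
    linear_combination this

end Sylvester

/-- The adjugate of a matrix of corank one is nonzero. -/
lemma adjugate_ne_zero_of_kernel {ι K : Type*} [Fintype ι] [DecidableEq ι] [Field K]
    {M : Matrix ι ι K} {μ : ι → K} (hμ0 : μ ≠ 0) (hμ : M.mulVec μ = 0)
    (hker : ∀ w w', Matrix.vecMul w M = 0 → Matrix.vecMul w' M = 0 → w ≠ 0 → ∃ s : K, w' = s • w) :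
    M.adjugate ≠ 0 := by
  intro hadj
  obtain ⟨w, hw0, hw⟩ := Matrix.exists_vecMul_eq_zero_iff.2
    (Matrix.exists_mulVec_eq_zero_iff.1 ⟨μ, hμ0, hμ⟩)
  obtain ⟨i, hi⟩ := Function.ne_iff.1 hw0
  obtain ⟨k, hk⟩ := Function.ne_iff.1 hμ0
  have h1 : (M.updateRow i (Pi.single k 1)).det = 0 := by
    rw [← Matrix.adjugate_apply, hadj]; rfl
  obtain ⟨v, hv0, hv⟩ := Matrix.exists_vecMul_eq_zero_iff.2 h1
  have h2 : (M.updateRow i (Pi.single k 1)).mulVec μ = Pi.single i (μ k) := by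
    funext j
    by_cases hj : j = i
    · subst hj
      simp [Matrix.mulVec, Matrix.updateRow_self]
    · rw [Pi.single_eq_of_ne hj, Matrix.mulVec, Matrix.updateRow_ne hj]
      exact congrFun hμ j
  have hvi : v i = 0 := by
    have h3 : v ⬝ᵥ (M.updateRow i (Pi.single k 1)).mulVec μ = 0 := by
      rw [Matrix.dotProduct_mulVec, hv, zero_dotProduct]
    rw [h2, dotProduct_single] at h3
    exact (mul_eq_zero.1 h3).resolve_right hk
  have hvM : Matrix.vecMul v M = 0 := by
    rw [← hv]
    funext κ
    refine Finset.sum_congr rfl fun j _ => ?_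
    by_cases hj : j = i
    · rw [hj, hvi, zero_mul, zero_mul]
    · simp only [Matrix.updateRow_ne hj]
  obtain ⟨s, rfl⟩ := hker w v hw hvM hw0
  have hs : s = 0 := (mul_eq_zero.1 hvi).resolve_right hi
  exact hv0 (by rw [hs, zero_smul])

section Sylvester

open Polynomial

variable {N : ℕ}

lemma map_syl {R R' : Type*} [CommRing R] [CommRing R'] (φ : R →+* R') (c : ℕ → R) :
    (syl N c).map φ = syl N (fun i => φ (c i)) := by
  ext ρ κ
  simp only [syl, Matrix.map_apply, Matrix.of_apply]
  split_ifs <;> simp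

lemma eval_derivative_syl (c : ℕ → ℂ[X]) (x : ℂ) (ρ κ : Fin N ⊕ Fin N) :
    (derivative (syl N c ρ κ)).eval x = syl N (fun i => (derivative (c i)).eval x) ρ κ := by
  simp only [syl, Matrix.of_apply]
  split_ifs <;> simp

/-- Roots of the discriminant attached to a nondegenerate vertical tangency are simple. -/
lemma eval_derivative_det_syl_ne_zero (hN : 0 < N) {c : ℕ → ℂ[X]} {x₀ y₀ : ℂ} {c₀ c₁ : ℕ → ℂ}
    (hc₀ : ∀ i, c₀ i = (c i).eval x₀) (hc₁ : ∀ i, c₁ i = (derivative (c i)).eval x₀)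
    (htop : c₀ (N + 1) = 0 → c₀ N ≠ 0) (hbot : c₀ 0 = 0 → c₀ 1 ≠ 0)
    (h1 : (coeffPoly N c₀).eval y₀ = 0)
    (h2 : (derivative (coeffPoly N c₀)).eval y₀ = 0)
    (h3 : (derivative (derivative (coeffPoly N c₀))).eval y₀ ≠ 0)
    (h4 : (coeffPoly N c₁).eval y₀ ≠ 0)
    (huniq : ∀ y ≠ 0, (coeffPoly N c₀).eval y = 0 → (derivative (coeffPoly N c₀)).eval y = 0 →
      y = y₀) :
    (derivative (syl N c).det).eval x₀ ≠ 0 := by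
  intro hE
  obtain rfl : c₀ = fun i => (c i).eval x₀ := funext hc₀
  obtain rfl : c₁ = fun i => (derivative (c i)).eval x₀ := funext hc₁
  set c₀ := fun i => (c i).eval x₀
  set c₁ := fun i => (derivative (c i)).eval x₀
  obtain ⟨A, B, hA, hB, hker⟩ := exists_kernel_description hN htop hbot h1 h2 h3 huniq
  have hs0 : ∀ w : Fin N ⊕ Fin N → ℂ, vecPoly (w ∘ Sum.inl) = Polynomial.C 0 * B →
      vecPoly (w ∘ Sum.inr) = -(Polynomial.C 0 * A) → w = 0 := fun w hU hV =>
    eq_zero_of_vecPoly (by simpa using hU) (by simpa using hV)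
  set μ : Fin N ⊕ Fin N → ℂ := fun κ => y₀ ^ (sylCol κ - 1) with hμ
  have hμ0 : μ ≠ 0 := by
    intro h
    have := congrFun h (Sum.inl ⟨0, hN⟩)
    simp [hμ, sylCol] at this
  have hμS : (syl N c₀).mulVec μ = 0 := syl_mulVec_pow_eq_zero h1 h2
  have hadj : (syl N c₀).adjugate ≠ 0 := by
    refine adjugate_ne_zero_of_kernel hμ0 hμS fun w w' hw hw' hw0 => ?_
    obtain ⟨s, hU, hV⟩ := hker w hw
    obtain ⟨s', hU', hV'⟩ := hker w' hw'
    have hs : s ≠ 0 := by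
      rintro rfl
      exact hw0 (hs0 w hU hV)
    refine ⟨s' / s, ?_⟩
    have e : Polynomial.C (s' / s) * Polynomial.C s = Polynomial.C s' := by
      rw [← Polynomial.C_mul, div_mul_cancel₀ _ hs]
    funext ρ
    rcases ρ with t | t
    · have := congrArg (fun g => g.coeff (t : ℕ)) hU'
      rw [← e, mul_assoc, ← hU] at this
      simpa [coeff_vecPoly] using this
    · have := congrArg (fun g => g.coeff (t : ℕ)) hV'
      rw [← e, mul_assoc, ← mul_neg, ← hV] at this
      simpa [coeff_vecPoly] using this
  have hmap : ∀ i j, ((syl N c).adjugate i j).eval x₀ = (syl N c₀).adjugate i j := by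
    intro i j
    have h := RingHom.map_adjugate (Polynomial.evalRingHom x₀) (syl N c)
    rw [RingHom.mapMatrix_apply, RingHom.mapMatrix_apply, map_syl] at h
    exact congrFun (congrFun h i) j
  have hmapS : ∀ i j, (syl N c i j).eval x₀ = syl N c₀ i j := fun i j =>
    congrFun (congrFun (map_syl (Polynomial.evalRingHom x₀) c) i) j
  have hder : ∀ i k, ∑ j, ((derivative ((syl N c).adjugate i j)).eval x₀ * syl N c₀ j k +
      (syl N c₀).adjugate i j * syl N c₁ j k) = 0 := by
    intro i k
    have h := congrFun (congrFun (Matrix.adjugate_mul (syl N c)) i) k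
    rw [Matrix.mul_apply, Matrix.smul_apply, Matrix.one_apply] at h
    have h' := congrArg (fun g => (derivative g).eval x₀) h
    simp only [Polynomial.derivative_sum, derivative_mul, Polynomial.eval_finsetSum,
      Polynomial.eval_add, Polynomial.eval_mul, hmap, hmapS, eval_derivative_syl] at h'
    refine h'.trans ?_
    split_ifs <;> simp [hE]
  have hw : ∀ i, ∑ j, (syl N c₀).adjugate i j * (syl N c₁).mulVec μ j = 0 := by
    intro i
    have h5 : ∑ k, (∑ j, ((derivative ((syl N c).adjugate i j)).eval x₀ * syl N c₀ j k +
      (syl N c₀).adjugate i j * syl N c₁ j k)) * μ k = 0 :=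
      Finset.sum_eq_zero fun k _ => by rw [hder, zero_mul]
    simp only [Finset.sum_mul] at h5
    rw [Finset.sum_comm] at h5
    simp only [add_mul, Finset.sum_add_distrib, mul_assoc, ← Finset.mul_sum] at h5
    have h6 : ∀ j, ∑ k, syl N c₀ j k * μ k = 0 := fun j => congrFun hμS j
    simp only [h6, mul_zero, Finset.sum_const_zero, zero_add] at h5
    exact h5
  obtain ⟨i, hi⟩ := Function.ne_iff.1 hadj
  set w := (syl N c₀).adjugate i with hwdef
  have hwS : Matrix.vecMul w (syl N c₀) = 0 := by
    have h7 : (syl N c₀).det = 0 := det_syl_eq_zero_of_root hN h1 h2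
    have h8 := congrFun (Matrix.adjugate_mul (syl N c₀)) i
    rw [h7, zero_smul] at h8
    exact h8
  obtain ⟨s, hU, hV⟩ := hker w hwS
  have hs : s ≠ 0 := by
    rintro rfl
    exact hi (hs0 w hU hV)
  have h9 := sum_mul_syl_mul_pow c₁ w y₀
  have h10 : ∑ κ, (Matrix.vecMul w (syl N c₁)) κ * y₀ ^ (sylCol κ - 1) = 0 := by
    have : w ⬝ᵥ (syl N c₁).mulVec μ = 0 := hw i
    rwa [Matrix.dotProduct_mulVec] at this
  rw [h10, hU, hV, eval_eulerPoly] at h9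
  simp only [Polynomial.eval_mul, Polynomial.eval_neg, Polynomial.eval_C, hA, hB] at h9
  have h11 : s * (derivative (derivative (coeffPoly N c₀))).eval y₀ *
      (((N : ℂ) + 1) * (coeffPoly N c₁).eval y₀) = 0 := by linear_combination -h9
  have hN1 : ((N : ℂ) + 1) ≠ 0 := by exact_mod_cast N.succ_ne_zero
  exact mul_ne_zero (mul_ne_zero hs h3) (mul_ne_zero hN1 h4) h11

end Sylvester

section Count

open Polynomial

/-- A complex polynomial whose nonzero roots are simple has as many nonzero roots as the length of
its Newton segment. -/
lemma ncard_nonzero_roots {E : ℂ[X]} {b b' : ℝ} {l l' : ℂ} (h : IsLead 1 b E l) (hl : l ≠ 0)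
    (h' : IsLead (-1) b' E l') (hl' : l' ≠ 0)
    (hsimple : ∀ x ≠ 0, E.eval x = 0 → (derivative E).eval x ≠ 0) :
    {x | x ≠ 0 ∧ E.eval x = 0}.Finite ∧ ({x | x ≠ 0 ∧ E.eval x = 0}.ncard : ℝ) = b + b' := by
  obtain ⟨p, rfl⟩ := h.2.2 hl
  obtain ⟨q, rfl⟩ := h'.2.2 hl'
  have hp : E.coeff p ≠ 0 := by rwa [h.2.1 p rfl]
  have hq : E.coeff q ≠ 0 := by rwa [h'.2.1 q rfl]
  have hgt : ∀ j, p < j → E.coeff j = 0 := fun j hj => h.1 j (by simpa using hj)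
  have hlt : ∀ j, j < q → E.coeff j = 0 := fun j hj => h'.1 j (by simpa using hj)
  have hqp : q ≤ p := by
    by_contra hcon
    exact hp (hlt p (by omega))
  obtain ⟨G, hG⟩ := Polynomial.X_pow_dvd_iff.2 hlt
  have hGc : ∀ j, G.coeff j = E.coeff (j + q) := fun j => by rw [hG, Polynomial.coeff_X_pow_mul]
  have hG0 : G.eval 0 ≠ 0 := by
    rw [← Polynomial.coeff_zero_eq_eval_zero, hGc, zero_add]
    exact hq
  have hGne : G ≠ 0 := by rintro rfl; simp at hG0
  have hdeg : G.natDegree = p - q := by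
    refine le_antisymm (Polynomial.natDegree_le_iff_coeff_eq_zero.2 fun j hj => ?_)
      (Polynomial.le_natDegree_of_ne_zero ?_)
    · rw [hGc, hgt _ (by omega)]
    · rw [hGc, Nat.sub_add_cancel hqp]
      exact hp
  have hroot : ∀ x, x ≠ 0 ∧ E.eval x = 0 ↔ G.eval x = 0 := by
    intro x
    rw [hG]
    simp only [Polynomial.eval_mul, Polynomial.eval_pow, Polynomial.eval_X, mul_eq_zero]
    constructor
    · rintro ⟨hx, h | h⟩
      · exact absurd h (pow_ne_zero q hx)
      · exact h
    · intro h
      refine ⟨?_, Or.inr h⟩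
      rintro rfl
      exact hG0 h
  have hsep : G.Separable := by
    refine isCoprime_of_no_common_root fun x hx hx' => ?_
    obtain ⟨h1, h2⟩ := (hroot x).2 hx
    refine hsimple x h1 h2 ?_
    rw [hG, derivative_mul]
    simp [hx, hx']
  have hset : {x | x ≠ 0 ∧ E.eval x = 0} = (G.roots.toFinset : Set ℂ) := by
    ext x
    rw [Set.mem_ofPred_eq, hroot]
    simp [hGne]
  rw [hset]
  refine ⟨Finset.finite_toSet _, ?_⟩
  rw [Set.ncard_coe_finset, Multiset.toFinset_card_of_nodup (Polynomial.nodup_roots hsep),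
    ← (IsAlgClosed.splits G).natDegree_eq_card_roots, hdeg, Nat.cast_sub hqp]
  ring

variable {S : Type*} [Fintype S] {N : ℕ} {px iy : S → ℕ}

lemma sum_eval_rowPoly_mul (hiy : ∀ k, iy k ≤ N + 1) (a : S → ℂ) (x : ℂ) (g : ℕ → ℂ) :
    ∑ i ∈ Finset.range (N + 2), (rowPoly px iy a i).eval x * g i =
      ∑ k, a k * (x ^ px k * g (iy k)) := by
  classical
  rw [← Finset.sum_fiberwise_of_maps_to (s := Finset.univ) (t := Finset.range (N + 2)) (g := iy)
    (fun k _ => by have := hiy k; simp only [Finset.mem_range]; omega)]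
  refine Finset.sum_congr rfl fun i _ => ?_
  rw [rowPoly, Polynomial.eval_finsetSum, Finset.sum_mul]
  refine Finset.sum_congr rfl fun k hk => ?_
  have hk' : iy k = i := by simpa using hk
  simp [hk', mul_assoc]

lemma eval_coeffPoly_rowPoly (hiy : ∀ k, iy k ≤ N + 1) (a : S → ℂ) (x y : ℂ) :
    (coeffPoly N fun i => (rowPoly px iy a i).eval x).eval y =
      ∑ k, a k * (x ^ px k * y ^ iy k) := by
  rw [← sum_eval_rowPoly_mul hiy]
  simp [coeffPoly, Polynomial.eval_finsetSum]

lemma mul_eval_derivative_coeffPoly (c : ℕ → ℂ) (y : ℂ) :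
    y * (derivative (coeffPoly N c)).eval y =
      ∑ i ∈ Finset.range (N + 2), c i * (i * y ^ i) := by
  rw [coeffPoly, Polynomial.derivative_sum, Polynomial.eval_finsetSum, Finset.mul_sum]
  refine Finset.sum_congr rfl fun i _ => ?_
  cases i with
  | zero => simp
  | succ i => simp; ring

lemma sq_mul_eval_derivative_derivative_coeffPoly (c : ℕ → ℂ) (y : ℂ) :
    y ^ 2 * (derivative (derivative (coeffPoly N c))).eval y =
      ∑ i ∈ Finset.range (N + 2), c i * (i * (i - 1) * y ^ i) := by
  rw [coeffPoly, Polynomial.derivative_sum, Polynomial.derivative_sum, Polynomial.eval_finsetSum,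
    Finset.mul_sum]
  refine Finset.sum_congr rfl fun i _ => ?_
  rcases i with _ | _ | i
  · simp
  · simp
  · simp; ring

lemma mul_eval_derivative_rowPoly (a : S → ℂ) (x : ℂ) (i : ℕ) :
    x * (derivative (rowPoly px iy a i)).eval x =
      (rowPoly px iy (fun k => a k * px k) i).eval x := by
  rw [rowPoly, rowPoly, Polynomial.derivative_sum, Polynomial.eval_finsetSum,
    Polynomial.eval_finsetSum, Finset.mul_sum]
  refine Finset.sum_congr rfl fun k _ => ?_
  cases px k with
  | zero => simp
  | succ p => simp; ring

lemma mul_eval_coeffPoly_derivative_rowPoly (hiy : ∀ k, iy k ≤ N + 1) (a : S → ℂ) (x y : ℂ) :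
    x * (coeffPoly N fun i => (derivative (rowPoly px iy a i)).eval x).eval y =
      ∑ k, a k * (px k * (x ^ px k * y ^ iy k)) := by
  have h : x * (coeffPoly N fun i => (derivative (rowPoly px iy a i)).eval x).eval y =
      (coeffPoly N fun i => (rowPoly px iy (fun k => a k * px k) i).eval x).eval y := by
    simp only [coeffPoly, Polynomial.eval_finsetSum, Polynomial.eval_mul, Polynomial.eval_C,
      Finset.mul_sum, ← mul_assoc, mul_eval_derivative_rowPoly]
  rw [h, eval_coeffPoly_rowPoly hiy]
  simp only [mul_assoc]

/-- The weighted sum `∑ k, a k * g k * x ^ px k * y ^ iy k`. -/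
def wtSum (px iy : S → ℕ) (g : S → ℂ) (a : S → ℂ) (x y : ℂ) : ℂ :=
  ∑ k, g k * (x ^ px k * y ^ iy k) * a k

/-- The points of the torus where `f = ∑ k, a k * x ^ px k * y ^ iy k` and `y * ∂f/∂y` vanish. -/
def tangencySet (px iy : S → ℕ) (a : S → ℂ) : Set (ℂ × ℂ) :=
  {p | p.1 ≠ 0 ∧ p.2 ≠ 0 ∧ wtSum px iy (fun _ => 1) a p.1 p.2 = 0 ∧
    wtSum px iy (fun k => iy k) a p.1 p.2 = 0}

/-- The number of vertical tangents of a sufficiently nondegenerate curve. -/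
lemma ncard_tangencySet (hN : 0 < N) (hiy : ∀ k, iy k ≤ N + 1) {a : S → ℂ} {b b' : ℝ} {l l' : ℂ}
    (h : IsLead 1 b (syl N (rowPoly px iy a)).det l) (hl : l ≠ 0)
    (h' : IsLead (-1) b' (syl N (rowPoly px iy a)).det l') (hl' : l' ≠ 0)
    (hyy : ∀ p ∈ tangencySet px iy a, wtSum px iy (fun k => iy k * (iy k - 1)) a p.1 p.2 ≠ 0)
    (hx : ∀ p ∈ tangencySet px iy a, wtSum px iy (fun k => px k) a p.1 p.2 ≠ 0)
    (hinj : Set.InjOn Prod.fst (tangencySet px iy a))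
    (htop : ∀ x ≠ 0, (rowPoly px iy a (N + 1)).eval x = 0 → (rowPoly px iy a N).eval x ≠ 0)
    (hbot : ∀ x ≠ 0, (rowPoly px iy a 0).eval x = 0 → (rowPoly px iy a 1).eval x ≠ 0) :
    (tangencySet px iy a).Finite ∧ ((tangencySet px iy a).ncard : ℝ) = b + b' := by
  have hF : ∀ x y, (coeffPoly N fun i => (rowPoly px iy a i).eval x).eval y =
      wtSum px iy (fun _ => 1) a x y := by
    intro x y
    rw [eval_coeffPoly_rowPoly hiy, wtSum]
    exact Finset.sum_congr rfl fun k _ => by ring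
  have hFy : ∀ x y, y * (derivative (coeffPoly N fun i => (rowPoly px iy a i).eval x)).eval y =
      wtSum px iy (fun k => iy k) a x y := by
    intro x y
    rw [mul_eval_derivative_coeffPoly, sum_eval_rowPoly_mul hiy a x (fun i => i * y ^ i), wtSum]
    exact Finset.sum_congr rfl fun k _ => by ring
  have hFyy : ∀ x y, y ^ 2 * (derivative (derivative
      (coeffPoly N fun i => (rowPoly px iy a i).eval x))).eval y =
      wtSum px iy (fun k => iy k * (iy k - 1)) a x y := by
    intro x y
    rw [sq_mul_eval_derivative_derivative_coeffPoly,
      sum_eval_rowPoly_mul hiy a x (fun i => i * (i - 1) * y ^ i), wtSum]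
    exact Finset.sum_congr rfl fun k _ => by ring
  have hFx : ∀ x y, x * (coeffPoly N fun i => (derivative (rowPoly px iy a i)).eval x).eval y =
      wtSum px iy (fun k => px k) a x y := by
    intro x y
    rw [mul_eval_coeffPoly_derivative_rowPoly hiy, wtSum]
    exact Finset.sum_congr rfl fun k _ => by ring
  have hmem : ∀ p : ℂ × ℂ, p ∈ tangencySet px iy a ↔ p.1 ≠ 0 ∧ p.2 ≠ 0 ∧
      (coeffPoly N fun i => (rowPoly px iy a i).eval p.1).eval p.2 = 0 ∧
      (derivative (coeffPoly N fun i => (rowPoly px iy a i).eval p.1)).eval p.2 = 0 := by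
    intro p
    rw [tangencySet, Set.mem_ofPred_eq, ← hF, ← hFy]
    refine and_congr_right fun _ => and_congr_right fun hy => and_congr_right fun _ => ?_
    rw [mul_eq_zero, or_iff_right hy]
  have hdet : ∀ x, ((syl N (rowPoly px iy a)).det).eval x =
      (syl N fun i => (rowPoly px iy a i).eval x).det := by
    intro x
    have := RingHom.map_det (Polynomial.evalRingHom x) (syl N (rowPoly px iy a))
    rw [RingHom.mapMatrix_apply, map_syl] at this
    exact this
  have himg : Prod.fst '' tangencySet px iy a =
      {x | x ≠ 0 ∧ ((syl N (rowPoly px iy a)).det).eval x = 0} := by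
    ext x
    simp only [Set.mem_image, Set.mem_ofPred_eq, Prod.exists, exists_and_right, exists_eq_right]
    constructor
    · rintro ⟨y, hy⟩
      obtain ⟨h1, -, h3, h4⟩ := (hmem _).1 hy
      exact ⟨h1, by rw [hdet]; exact det_syl_eq_zero_of_root hN h3 h4⟩
    · rintro ⟨h1, h2⟩
      rw [hdet] at h2
      obtain ⟨y, hy, h3, h4⟩ := exists_root_of_det_syl_eq_zero (htop x h1) (hbot x h1) h2
      exact ⟨y, (hmem _).2 ⟨h1, hy, h3, h4⟩⟩
  have hroots := ncard_nonzero_roots h hl h' hl' fun x hx0 hE => by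
    have hx' : x ∈ Prod.fst '' tangencySet px iy a := by rw [himg]; exact ⟨hx0, hE⟩
    obtain ⟨⟨x, y⟩, hp, rfl⟩ := hx'
    obtain ⟨-, hy, h3, h4⟩ := (hmem _).1 hp
    have h5 := hyy _ hp
    have h6 := hx _ hp
    rw [← hFyy] at h5
    rw [← hFx] at h6
    refine eval_derivative_det_syl_ne_zero hN (fun _ => rfl) (fun _ => rfl) (htop x hx0)
      (hbot x hx0) h3 h4 (right_ne_zero_of_mul h5) (right_ne_zero_of_mul h6) fun y' hy' h7 h8 => ?_
    exact congrArg Prod.snd (hinj ((hmem (x, y')).2 ⟨hx0, hy', h7, h8⟩) hp rfl)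
  rw [← himg] at hroots
  refine ⟨Set.Finite.of_finite_image hroots.1 hinj, ?_⟩
  rw [← hroots.2, hinj.ncard_image]

end Count

section Generic

variable {S : Type*} [Fintype S]

/-- A generic tuple `a` is not annihilated by `q + 1` independent monomial conditions at any point
of the `q`-dimensional torus. -/
lemma exists_generic_monomial {q : ℕ} (ν : S → Fin q → ℕ) (g : Fin (q + 1) → S → ℂ)
    (e : Fin (q + 1) → S) (hdet : (Matrix.of fun ρ j => g ρ (e j)).det ≠ 0) :
    ∃ D : MvPolynomial S ℂ, D ≠ 0 ∧ ∀ a : S → ℂ, eval a D ≠ 0 → ∀ t : Fin q → ℂ, (∀ i, t i ≠ 0) →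
      ∃ ρ, ∑ k, g ρ k * (∏ i, t i ^ ν k i) * a k ≠ 0 := by
  have he : Function.Injective e := by
    intro i j hij
    by_contra hne
    exact hdet (Matrix.det_zero_of_column_eq hne fun ρ => by simp [hij])
  obtain ⟨D, hD0, hD⟩ := exists_generic_avoid q.lt_succ_self
    (Matrix.of fun ρ k => C (g ρ k) * ∏ i, (X i : MvPolynomial (Fin q) ℂ) ^ ν k i) e he
  refine ⟨D, hD0, fun a ha t ht => ?_⟩
  by_contra! hcon
  refine ha (hD a t ?_ fun ρ => ?_)
  · rw [RingHom.map_det]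
    have : (RingHom.mapMatrix (eval t)) ((Matrix.of fun ρ k =>
        C (g ρ k) * ∏ i, (X i : MvPolynomial (Fin q) ℂ) ^ ν k i).submatrix id e) =
        Matrix.of fun ρ j => (∏ i, t i ^ ν (e j) i) * (Matrix.of fun ρ j => g ρ (e j)) ρ j := by
      ext ρ j
      simp [mul_comm]
    rw [this, Matrix.det_mul_row]
    exact mul_ne_zero (Finset.prod_ne_zero_iff.2 fun j _ =>
      Finset.prod_ne_zero_iff.2 fun i _ => pow_ne_zero _ (ht i)) hdet
  · simpa using hcon ρ

variable {px iy : S → ℕ}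

lemma exists_generic_wtSum (g : Fin 3 → S → ℂ) (e : Fin 3 → S)
    (hdet : (Matrix.of fun ρ j => g ρ (e j)).det ≠ 0) :
    ∃ D : MvPolynomial S ℂ, D ≠ 0 ∧ ∀ a : S → ℂ, eval a D ≠ 0 → ∀ x y : ℂ, x ≠ 0 → y ≠ 0 →
      ∃ ρ, wtSum px iy (g ρ) a x y ≠ 0 := by
  obtain ⟨D, hD0, hD⟩ := exists_generic_monomial (fun k => ![px k, iy k]) g e hdet
  refine ⟨D, hD0, fun a ha x y hx hy => ?_⟩
  simpa [wtSum, Fin.prod_univ_two] using hD a ha ![x, y] (by simp [Fin.forall_fin_two, hx, hy])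

lemma exists_generic_rows {i j : ℕ} (hij : i ≠ j) {k : S} (hk : iy k = i)
    (h : (∃ k', iy k' = j) ∨ ∀ k', iy k' = i → k' = k) :
    ∃ D : MvPolynomial S ℂ, D ≠ 0 ∧ ∀ a : S → ℂ, eval a D ≠ 0 → ∀ x : ℂ, x ≠ 0 →
      (rowPoly px iy a i).eval x = 0 → (rowPoly px iy a j).eval x ≠ 0 := by
  classical
  rcases h with ⟨k', hk'⟩ | h
  · obtain ⟨D, hD0, hD⟩ := exists_generic_monomial (q := 1) (fun k _ => px k)
      ![fun k => if iy k = i then 1 else 0, fun k => if iy k = j then 1 else 0] ![k, k']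
      (by simp [Matrix.det_fin_two, hk, hk', hij])
    refine ⟨D, hD0, fun a ha x hx => ?_⟩
    have := hD a ha (fun _ => x) (fun _ => hx)
    rw [Fin.exists_fin_two] at this
    simp only [Matrix.cons_val_zero, Matrix.cons_val_one, Fin.prod_univ_one, ite_mul, one_mul,
      zero_mul, ← Finset.sum_filter] at this
    simp only [rowPoly, Polynomial.eval_finsetSum, Polynomial.eval_mul, Polynomial.eval_C,
      Polynomial.eval_pow, Polynomial.eval_X, mul_comm (a _)]
    exact fun h0 => this.resolve_left (not_not.2 h0)
  · refine ⟨X k, X_ne_zero k, fun a ha x hx h0 => ?_⟩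
    rw [eval_X] at ha
    rw [rowPoly, Polynomial.eval_finsetSum, Finset.sum_eq_single k] at h0
    · simp [ha, hx] at h0
    · intro b hb hne
      exact absurd (h b (by simpa using hb)) hne
    · simp [hk]

lemma wtSum_sub_const (g : S → ℂ) (b : ℂ) (a : S → ℂ) (x y : ℂ) :
    wtSum px iy (fun k => g k - b) a x y =
      wtSum px iy g a x y - b * wtSum px iy (fun _ => 1) a x y := by
  simp only [wtSum, Finset.mul_sum, ← Finset.sum_sub_distrib]
  exact Finset.sum_congr rfl fun k _ => by ring

lemma det_two_double_points (u v : ℂ) :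
    (Matrix.of ![fun j : Fin 4 => u ^ (j : ℕ), fun j => (j : ℕ) * u ^ (j : ℕ),
      fun j => v ^ (j : ℕ), fun j => (j : ℕ) * v ^ (j : ℕ)]).det = u * v * (u - v) ^ 4 := by
  simp [Matrix.det_succ_row_zero, Fin.sum_univ_succ, Fin.succAbove]
  ring

/-- For generic coefficients no vertical line is tangent to the curve at two points. -/
lemma exists_generic_injOn {p l : ℕ} (e : Fin 4 → S) (hp : ∀ j, px (e j) = p)
    (hl : ∀ j, iy (e j) = l + j) :
    ∃ D : MvPolynomial S ℂ, D ≠ 0 ∧ ∀ a : S → ℂ, eval a D ≠ 0 →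
      Set.InjOn Prod.fst (tangencySet px iy a) := by
  have he : Function.Injective e := by
    intro i j hij
    have h1 := hl i
    rw [hij, hl j] at h1
    exact Fin.ext (by omega)
  let m : Fin 2 → S → MvPolynomial (Fin 3) ℂ := fun i k => X 0 ^ px k * X i.succ ^ iy k
  obtain ⟨D, hD0, hD⟩ := exists_generic_avoid (q := 3) (m := 4) (by omega)
    (Matrix.of ![fun k => m 0 k, fun k => C ((iy k : ℂ) - l) * m 0 k, fun k => m 1 k,
      fun k => C ((iy k : ℂ) - l) * m 1 k]) e he
  refine ⟨D, hD0, fun a ha => ?_⟩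
  rintro ⟨x, u⟩ ⟨hx, hu, h1, h2⟩ ⟨x', v⟩ ⟨-, hv, h3, h4⟩ hxx
  simp only at hx hu hv h1 h2 h3 h4 hxx
  subst hxx
  by_contra hne
  have huv : u - v ≠ 0 := by
    rw [sub_ne_zero]
    rintro rfl
    exact hne rfl
  refine ha (hD a ![x, u, v] ?_ ?_)
  · rw [RingHom.map_det]
    have : (RingHom.mapMatrix (eval ![x, u, v])) ((Matrix.of ![fun k => m 0 k,
        fun k => C ((iy k : ℂ) - l) * m 0 k, fun k => m 1 k,
        fun k => C ((iy k : ℂ) - l) * m 1 k]).submatrix id e) =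
        Matrix.of fun i j => ![x ^ p * u ^ l, x ^ p * u ^ l, x ^ p * v ^ l, x ^ p * v ^ l] i *
          (Matrix.of ![fun j : Fin 4 => u ^ (j : ℕ), fun j => (j : ℕ) * u ^ (j : ℕ),
            fun j => v ^ (j : ℕ), fun j => (j : ℕ) * v ^ (j : ℕ)]) i j := by
      ext i j
      fin_cases i <;> simp [m, hp, hl, pow_add] <;> ring
    rw [this, Matrix.det_mul_column, det_two_double_points]
    simp [Fin.prod_univ_succ, hx, hu, hv, huv]
  · have h5 := wtSum_sub_const (px := px) (iy := iy) (fun k => iy k) l a x u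
    have h6 := wtSum_sub_const (px := px) (iy := iy) (fun k => iy k) l a x v
    rw [h1, h2, mul_zero, sub_zero] at h5
    rw [h3, h4, mul_zero, sub_zero] at h6
    intro ρ
    fin_cases ρ
    · simpa [m, wtSum] using h1
    · simpa [m, wtSum] using h5
    · simpa [m, wtSum] using h3
    · simpa [m, wtSum] using h6

/-- The number of vertical tangents for generic coefficients, in combinatorial terms. -/
lemma exists_generic_ncard_tangencySet {N : ℕ} (hN : 0 < N) (hiy : ∀ k, iy k ≤ N + 1)
    (hinj : Function.Injective fun k => (px k, iy k)) {r r' : ℕ → ℝ}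
    (hr : DiscreteConcave (N + 1) r) (hle : ∀ k, px k ≤ r (iy k))
    (hbr : ∀ i ≤ N + 1, IsBreak (N + 1) r i → ∃ k, iy k = i ∧ px k = r i)
    (hr' : DiscreteConcave (N + 1) r') (hle' : ∀ k, -(px k : ℝ) ≤ r' (iy k))
    (hbr' : ∀ i ≤ N + 1, IsBreak (N + 1) r' i → ∃ k, iy k = i ∧ -(px k : ℝ) = r' i)
    {p l : ℕ} {e : Fin 4 → S} (hep : ∀ j, px (e j) = p) (hel : ∀ j, iy (e j) = l + j)
    (hadj : ∃ k, px k = p + 1 ∧ iy k = l)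
    (htop : (∃ k, iy k = N) ∨ ∀ k k', iy k = N + 1 → iy k' = N + 1 → k = k')
    (hbot : (∃ k, iy k = 1) ∨ ∀ k k', iy k = 0 → iy k' = 0 → k = k') :
    ∃ D : MvPolynomial S ℂ, D ≠ 0 ∧ ∀ a : S → ℂ, eval a D ≠ 0 → (tangencySet px iy a).Finite ∧
      ((tangencySet px iy a).ncard : ℝ) =
        (∑ j ∈ Finset.range (N + 1), (r j + r (j + 1)) - r 0 - r (N + 1)) +
        (∑ j ∈ Finset.range (N + 1), (r' j + r' (j + 1)) - r' 0 - r' (N + 1)) := by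
  obtain ⟨k₁, hk₁p, hk₁l⟩ := hadj
  obtain ⟨kt, hkt, -⟩ := hbr (N + 1) le_rfl (Or.inr (Or.inl rfl))
  obtain ⟨kb, hkb, -⟩ := hbr 0 (Nat.zero_le _) (Or.inl rfl)
  obtain ⟨D₁, hD₁, H₁⟩ := exists_generic_lead (s := 1) one_ne_zero hinj hr (by simpa using hle)
    (by simpa using hbr)
  obtain ⟨D₂, hD₂, H₂⟩ := exists_generic_lead (s := -1) (by norm_num) hinj hr' (by simpa using hle')
    (by simpa using hbr')
  obtain ⟨D₃, hD₃, H₃⟩ := exists_generic_wtSum (px := px) (iy := iy)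
    ![fun _ => 1, fun k => iy k, fun k => iy k * (iy k - 1)] (fun j => e j.castSucc) (by
      rw [Matrix.det_fin_three]
      simp [hel]
      ring_nf
      norm_num)
  obtain ⟨D₄, hD₄, H₄⟩ := exists_generic_wtSum (px := px) (iy := iy)
    ![fun _ => 1, fun k => iy k, fun k => px k] ![e 0, e 1, k₁] (by
      rw [Matrix.det_fin_three]
      simp [hel, hep, hk₁p, hk₁l]
      ring_nf
      norm_num)
  obtain ⟨D₅, hD₅, H₅⟩ := exists_generic_injOn (px := px) (iy := iy) e hep hel
  obtain ⟨D₆, hD₆, H₆⟩ := exists_generic_rows (px := px) (N.lt_succ_self.ne') hkt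
    (htop.imp_right fun h k' hk' => h _ _ hk' hkt)
  obtain ⟨D₇, hD₇, H₇⟩ := exists_generic_rows (px := px) zero_ne_one hkb
    (hbot.imp_right fun h k' hk' => h _ _ hk' hkb)
  refine ⟨D₁ * D₂ * D₃ * D₄ * D₅ * D₆ * D₇, by simp [*], fun a ha => ?_⟩
  simp only [map_mul, mul_ne_zero_iff] at ha
  obtain ⟨⟨⟨⟨⟨⟨h₁, h₂⟩, h₃⟩, h₄⟩, h₅⟩, h₆⟩, h₇⟩ := ha
  obtain ⟨l₁, hl₁, hL₁⟩ := H₁ a h₁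
  obtain ⟨l₂, hl₂, hL₂⟩ := H₂ a h₂
  refine ncard_tangencySet hN hiy hL₁ hl₁ hL₂ hl₂ ?_ ?_ (H₅ a h₅) (H₆ a h₆) (H₇ a h₇)
  · rintro ⟨x, y⟩ ⟨hx, hy, h1, h2⟩ h3
    obtain ⟨ρ, hρ⟩ := H₃ a h₃ x y hx hy
    fin_cases ρ
    exacts [hρ h1, hρ h2, hρ h3]
  · rintro ⟨x, y⟩ ⟨hx, hy, h1, h2⟩ h3
    obtain ⟨ρ, hρ⟩ := H₄ a h₄ x y hx hy
    fin_cases ρ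
    exacts [hρ h1, hρ h2, hρ h3]

end Generic

section Polygon

/-- The right end of the horizontal slice of `P` at height `y`. -/
def rightEnd (P : Set (ℝ × ℝ)) (y : ℝ) : ℝ := sSup {x | (x, y) ∈ P}

/-- The image of `P` under the reflection `(x, y) ↦ (-x, y)`. -/
def reflect (P : Set (ℝ × ℝ)) : Set (ℝ × ℝ) := {p | (-p.1, p.2) ∈ P}

/-- `P` is the convex hull of the lattice points `V`, whose rows range from `c` to `d`. -/
structure HullRows (P : Set (ℝ × ℝ)) (V : Finset (ℤ × ℤ)) (c d : ℤ) : Prop where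
  eq_hull : P = convexHull ℝ (rpt '' (V : Set (ℤ × ℤ)))
  le_row : ∀ k ∈ V, c ≤ k.2
  row_le : ∀ k ∈ V, k.2 ≤ d
  exists_bot : ∃ k ∈ V, k.2 = c
  exists_top : ∃ k ∈ V, k.2 = d

namespace HullRows

variable {P : Set (ℝ × ℝ)} {V : Finset (ℤ × ℤ)} {c d : ℤ}

lemma convex (h : HullRows P V c d) : Convex ℝ P := by
  rw [h.eq_hull]; exact convex_convexHull ℝ _

lemma isCompact (h : HullRows P V c d) : IsCompact P := by
  rw [h.eq_hull]
  exact (V.finite_toSet.image rpt).isCompact_convexHull (𝕜 := ℝ)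

lemma rpt_mem (h : HullRows P V c d) {k : ℤ × ℤ} (hk : k ∈ V) : rpt k ∈ P := by
  rw [h.eq_hull]
  exact subset_convexHull ℝ _ ⟨k, hk, rfl⟩

/-- A half plane containing the vertices contains the polygon. -/
lemma le_of_forall_vertex (h : HullRows P V c d) {α β γ : ℝ}
    (hV : ∀ k ∈ V, α * k.1 + β * k.2 ≤ γ) {p : ℝ × ℝ} (hp : p ∈ P) : α * p.1 + β * p.2 ≤ γ := by
  have hconv : Convex ℝ {p : ℝ × ℝ | α * p.1 + β * p.2 ≤ γ} := by
    intro p hp q hq s t hs ht hst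
    simp only [Set.mem_ofPred_eq, Prod.fst_add, Prod.snd_add, Prod.smul_fst, Prod.smul_snd,
      smul_eq_mul] at hp hq ⊢
    have e : α * (s * p.1 + t * q.1) + β * (s * p.2 + t * q.2) =
        s * (α * p.1 + β * p.2) + t * (α * q.1 + β * q.2) := by ring
    have e' : γ = s * γ + t * γ := by rw [← add_mul, hst, one_mul]
    rw [e, e']
    gcongr
  have hsub : convexHull ℝ (rpt '' (V : Set (ℤ × ℤ))) ⊆ {p : ℝ × ℝ | α * p.1 + β * p.2 ≤ γ} := by
    refine convexHull_min ?_ hconv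
    rintro _ ⟨k, hk, rfl⟩
    exact hV k hk
  exact hsub (h.eq_hull ▸ hp)

lemma le_snd (h : HullRows P V c d) {p : ℝ × ℝ} (hp : p ∈ P) : (c : ℝ) ≤ p.2 := by
  have := h.le_of_forall_vertex (α := 0) (β := -1) (γ := -c) (fun k hk => by
    have : (c : ℝ) ≤ k.2 := by exact_mod_cast h.le_row k hk
    linarith) hp
  linarith

lemma snd_le (h : HullRows P V c d) {p : ℝ × ℝ} (hp : p ∈ P) : p.2 ≤ (d : ℝ) := by
  have := h.le_of_forall_vertex (α := 0) (β := 1) (γ := d) (fun k hk => by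
    have : (k.2 : ℝ) ≤ d := by exact_mod_cast h.row_le k hk
    linarith) hp
  linarith

lemma combo_mem (h : HullRows P V c d) {x y x' y' : ℝ} (hp : (x, y) ∈ P) (hq : (x', y') ∈ P)
    {t : ℝ} (h0 : 0 ≤ t) (h1 : t ≤ 1) :
    ((1 - t) * x + t * x', (1 - t) * y + t * y') ∈ P := by
  have := h.convex hp hq (a := 1 - t) (b := t) (by linarith) h0 (by ring)
  simpa using this

lemma exists_mem_row (h : HullRows P V c d) {y : ℝ} (hc : (c : ℝ) ≤ y) (hd : y ≤ d) :
    ∃ x, (x, y) ∈ P := by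
  obtain ⟨k, hk, hkc⟩ := h.exists_bot
  obtain ⟨k', hk', hkd⟩ := h.exists_top
  have m1 : ((k.1 : ℝ), (c : ℝ)) ∈ P := by rw [← hkc]; exact h.rpt_mem hk
  have m2 : ((k'.1 : ℝ), (d : ℝ)) ∈ P := by rw [← hkd]; exact h.rpt_mem hk'
  rcases hc.eq_or_lt with rfl | hlt
  · exact ⟨_, m1⟩
  have hcd : 0 < (d : ℝ) - c := by linarith
  have := h.combo_mem m1 m2 (t := (y - c) / (d - c)) (by exact div_nonneg (by linarith) hcd.le)
    (by rw [div_le_one hcd]; linarith)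
  have e : (1 - (y - c) / (d - c)) * c + (y - c) / (d - c) * d = y := by field_simp; ring
  rw [e] at this
  exact ⟨_, this⟩

lemma isGreatest_rightEnd (h : HullRows P V c d) {y : ℝ} (hc : (c : ℝ) ≤ y) (hd : y ≤ d) :
    IsGreatest {x | (x, y) ∈ P} (rightEnd P y) := by
  have hcl : IsCompact {x | (x, y) ∈ P} := by
    have e : {x | (x, y) ∈ P} = Prod.fst '' (P ∩ {p | p.2 = y}) := by
      ext x
      simp
    rw [e]
    exact (h.isCompact.inter_right (isClosed_eq continuous_snd continuous_const)).image
      continuous_fst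
  exact hcl.isGreatest_sSup (h.exists_mem_row hc hd)

lemma rightEnd_mem (h : HullRows P V c d) {y : ℝ} (hc : (c : ℝ) ≤ y) (hd : y ≤ d) :
    (rightEnd P y, y) ∈ P := (h.isGreatest_rightEnd hc hd).1

lemma le_rightEnd (h : HullRows P V c d) {x y : ℝ} (hp : (x, y) ∈ P) : x ≤ rightEnd P y :=
  (h.isGreatest_rightEnd (h.le_snd hp) (h.snd_le hp)).2 hp

lemma vertex_le (h : HullRows P V c d) {j : ℤ} (hc : c ≤ j) (hd : j + 1 ≤ d) {k : ℤ × ℤ}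
    (hk : k ∈ V) :
    (k.1 : ℝ) ≤ rightEnd P j + (rightEnd P (j + 1) - rightEnd P j) * (k.2 - j) := by
  have hc' : (c : ℝ) ≤ j := by exact_mod_cast hc
  have hd' : (j : ℝ) + 1 ≤ d := by exact_mod_cast hd
  have m1 := h.rightEnd_mem (y := j) hc' (by linarith)
  have m2 := h.rightEnd_mem (y := j + 1) (by linarith) hd'
  set R₀ := rightEnd P j
  set R₁ := rightEnd P (j + 1)
  have mk : ((k.1 : ℝ), (k.2 : ℝ)) ∈ P := h.rpt_mem hk
  rcases le_or_gt k.2 j with hkj | hkj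
  · have hkj' : (k.2 : ℝ) ≤ j := by exact_mod_cast hkj
    have hpos : 0 < (j : ℝ) + 1 - k.2 := by linarith
    have m3 := h.combo_mem mk m2 (t := (j - k.2) / (j + 1 - k.2))
      (div_nonneg (by linarith) hpos.le) (by rw [div_le_one hpos]; linarith)
    have e : (1 - ((j : ℝ) - k.2) / (j + 1 - k.2)) * k.2 +
        (j - k.2) / (j + 1 - k.2) * (j + 1) = j := by field_simp; ring
    rw [e] at m3
    have h3 := h.le_rightEnd m3
    have e2 : (1 - ((j : ℝ) - k.2) / (j + 1 - k.2)) * k.1 +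
        (j - k.2) / (j + 1 - k.2) * R₁ = (k.1 + (j - k.2) * R₁) / (j + 1 - k.2) := by
      field_simp; ring
    rw [e2, div_le_iff₀ hpos] at h3
    linarith
  · have hkj' : (j : ℝ) + 1 ≤ k.2 := by exact_mod_cast hkj
    have hpos : 0 < (k.2 : ℝ) - j := by linarith
    have m3 := h.combo_mem m1 mk (t := 1 / (k.2 - j))
      (by positivity) (by rw [div_le_one hpos]; linarith)
    have e : (1 - 1 / ((k.2 : ℝ) - j)) * j + 1 / (k.2 - j) * k.2 = j + 1 := by
      field_simp; ring
    rw [e] at m3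
    have h3 := h.le_rightEnd m3
    have e2 : (1 - 1 / ((k.2 : ℝ) - j)) * R₀ + 1 / (k.2 - j) * k.1 =
        ((k.2 - j - 1) * R₀ + k.1) / (k.2 - j) := by
      field_simp
    rw [e2, div_le_iff₀ hpos] at h3
    linarith

/-- The right boundary is affine between consecutive lattice rows. -/
lemma rightEnd_affine (h : HullRows P V c d) {j : ℤ} (hc : c ≤ j) (hd : j + 1 ≤ d) {t : ℝ}
    (h0 : 0 ≤ t) (h1 : t ≤ 1) :
    rightEnd P (j + t) = (1 - t) * rightEnd P j + t * rightEnd P (j + 1) := by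
  have hc' : (c : ℝ) ≤ j := by exact_mod_cast hc
  have hd' : (j : ℝ) + 1 ≤ d := by exact_mod_cast hd
  have m1 := h.rightEnd_mem (y := j) hc' (by linarith)
  have m2 := h.rightEnd_mem (y := j + 1) (by linarith) hd'
  refine le_antisymm ?_ ?_
  · have m := h.rightEnd_mem (y := j + t) (by linarith) (by linarith)
    have := h.le_of_forall_vertex (α := 1) (β := rightEnd P j - rightEnd P (j + 1))
      (γ := rightEnd P j + j * (rightEnd P j - rightEnd P (j + 1)))
      (fun k hk => by linarith [h.vertex_le hc hd hk]) m
    simp only at this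
    linarith
  · have m := h.combo_mem m1 m2 h0 h1
    rw [show (1 - t) * (j : ℝ) + t * (j + 1) = j + t by ring] at m
    exact h.le_rightEnd m

lemma rightEnd_add_le (h : HullRows P V c d) {j : ℤ} (hc : c ≤ j) (hd : j + 2 ≤ d) :
    rightEnd P j + rightEnd P (j + 2) ≤ 2 * rightEnd P (j + 1) := by
  have hc' : (c : ℝ) ≤ j := by exact_mod_cast hc
  have hd' : (j : ℝ) + 2 ≤ d := by exact_mod_cast hd
  have m := h.combo_mem (h.rightEnd_mem (y := j) hc' (by linarith))
    (h.rightEnd_mem (y := j + 2) (by linarith) hd') (t := 1 / 2) (by norm_num) (by norm_num)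
  rw [show (1 - 1 / 2) * (j : ℝ) + 1 / 2 * (j + 2) = j + 1 by ring] at m
  linarith [h.le_rightEnd m]

lemma exists_vertex_of_lt (h : HullRows P V c d) {j : ℤ} (hc : c ≤ j) (hd : j ≤ d) {σ : ℝ}
    (hV : ∀ k ∈ V, k.2 ≠ j → (k.1 : ℝ) < rightEnd P j + σ * (k.2 - j)) :
    ∃ k ∈ V, k.2 = j ∧ (k.1 : ℝ) = rightEnd P j := by
  by_contra! hne
  have hc' : (c : ℝ) ≤ j := by exact_mod_cast hc
  have hd' : (j : ℝ) ≤ d := by exact_mod_cast hd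
  have hlt : ∀ k ∈ V, (1 : ℝ) * k.1 + -σ * k.2 < rightEnd P j - σ * j := fun k hk => by
    by_cases hkj : k.2 = j
    · have h1 : ((k.1 : ℝ), (k.2 : ℝ)) ∈ P := h.rpt_mem hk
      have h2 := lt_of_le_of_ne (h.le_rightEnd h1) (by rw [hkj]; exact hne k hk hkj)
      rw [hkj] at h2 ⊢
      linarith
    · linarith [hV k hk hkj]
  obtain ⟨k₀, hk₀, -⟩ := h.exists_bot
  obtain ⟨k, hk, hmax⟩ := V.exists_max_image (fun k => (1 : ℝ) * k.1 + -σ * k.2) ⟨k₀, hk₀⟩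
  have := h.le_of_forall_vertex hmax (h.rightEnd_mem hc' hd')
  have := hlt k hk
  simp only at *
  linarith

/-- The right boundary passes through a vertex in the extreme rows and wherever it bends. -/
lemma exists_vertex_of_break (h : HullRows P V c d) (hcd : c < d) {j : ℤ} (hc : c ≤ j)
    (hd : j ≤ d) (hj : j = c ∨ j = d ∨
      rightEnd P (j - 1) + rightEnd P (j + 1) < 2 * rightEnd P j) :
    ∃ k ∈ V, k.2 = j ∧ (k.1 : ℝ) = rightEnd P j := by
  rcases eq_or_lt_of_le hc with rfl | hc₁
  · refine h.exists_vertex_of_lt le_rfl hd (σ := rightEnd P (c + 1) - rightEnd P c + 1)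
      fun k hk hkc => ?_
    have h1 : (c : ℝ) < k.2 := by exact_mod_cast lt_of_le_of_ne (h.le_row k hk) (Ne.symm hkc)
    linarith [h.vertex_le le_rfl (by omega) hk]
  have low : ∀ k ∈ V, (k.1 : ℝ) ≤
      rightEnd P j + (rightEnd P j - rightEnd P (j - 1)) * (k.2 - j) := fun k hk => by
    have := h.vertex_le (j := j - 1) (by omega) (by omega) hk
    push_cast at this
    rw [sub_add_cancel] at this
    linarith
  rcases eq_or_lt_of_le hd with rfl | hd₁
  · refine h.exists_vertex_of_lt hc le_rfl (σ := rightEnd P j - rightEnd P (j - 1) - 1)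
      fun k hk hkc => ?_
    have h1 : (k.2 : ℝ) < j := by exact_mod_cast lt_of_le_of_ne (h.row_le k hk) hkc
    linarith [low k hk]
  have hlt : rightEnd P (j - 1) + rightEnd P (j + 1) < 2 * rightEnd P j :=
    (hj.resolve_left hc₁.ne').resolve_left hd₁.ne
  refine h.exists_vertex_of_lt hc hd (σ := (rightEnd P (j + 1) - rightEnd P (j - 1)) / 2)
    fun k hk hkj => ?_
  have h1 := low k hk
  have h2 := h.vertex_le hc (by omega) hk
  rcases lt_or_gt_of_ne hkj with hkj | hkj
  · have : (k.2 : ℝ) < j := by exact_mod_cast hkj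
    nlinarith
  · have : (j : ℝ) < k.2 := by exact_mod_cast hkj
    nlinarith

lemma discreteConcave_rightEnd (h : HullRows P V c d) {N : ℕ} (hN : c + (N + 1 : ℕ) = d) :
    DiscreteConcave (N + 1) fun i => rightEnd P (c + i) := by
  intro i hi
  have := h.rightEnd_add_le (j := c + i) (by omega) (by omega)
  push_cast at this ⊢
  simpa [add_assoc] using this

lemma exists_vertex_of_isBreak (h : HullRows P V c d) {N : ℕ} (hN : c + (N + 1 : ℕ) = d) {i : ℕ}
    (hi : i ≤ N + 1) (hb : IsBreak (N + 1) (fun i => rightEnd P (c + i)) i) :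
    ∃ k ∈ V, k.2 = c + i ∧ (k.1 : ℝ) = rightEnd P (c + i) := by
  have := h.exists_vertex_of_break (j := c + i) (by omega) (by omega) (by omega) (by
    rcases hb with rfl | rfl | ⟨h0, h1, h2⟩
    · simp
    · exact .inr (.inl hN)
    · refine .inr (.inr ?_)
      simp only [Nat.cast_sub (Nat.one_le_of_lt h0)] at h2
      push_cast at h2 ⊢
      simpa only [add_sub_assoc, add_assoc, Nat.cast_one] using h2)
  simpa using this

/-- Reflection in the vertical axis. -/
lemma reflect (h : HullRows P V c d) :
    HullRows (_root_.reflect P) (V.image fun k => (-k.1, k.2)) c d where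
  eq_hull := by
    let e : (ℝ × ℝ) →ₗ[ℝ] ℝ × ℝ := (-LinearMap.fst ℝ ℝ ℝ).prod (LinearMap.snd ℝ ℝ ℝ)
    have he : _root_.reflect P = e '' P := by
      ext p
      simp only [_root_.reflect, Set.mem_image, Set.mem_ofPred_eq]
      constructor
      · intro hp
        exact ⟨_, hp, by simp [e]⟩
      · rintro ⟨q, hq, rfl⟩
        simpa [e] using hq
    rw [he, h.eq_hull, LinearMap.image_convexHull, Finset.coe_image, Set.image_image,
      Set.image_image]
    simp [e, rpt]
  le_row := by simpa only [Finset.forall_mem_image] using h.le_row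
  row_le := by simpa only [Finset.forall_mem_image] using h.row_le
  exists_bot := by
    obtain ⟨k, hk, hkc⟩ := h.exists_bot
    exact ⟨_, Finset.mem_image_of_mem _ hk, hkc⟩
  exists_top := by
    obtain ⟨k, hk, hkc⟩ := h.exists_top
    exact ⟨_, Finset.mem_image_of_mem _ hk, hkc⟩

/-- The horizontal slice of `P` at height `y`. -/
lemma mem_iff (h : HullRows P V c d) {x y : ℝ} (hc : (c : ℝ) ≤ y) (hd : y ≤ d) :
    (x, y) ∈ P ↔ -rightEnd (_root_.reflect P) y ≤ x ∧ x ≤ rightEnd P y := by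
  constructor
  · intro hp
    have : (-x, y) ∈ _root_.reflect P := by simpa [_root_.reflect] using hp
    exact ⟨by linarith [h.reflect.le_rightEnd this], h.le_rightEnd hp⟩
  · rintro ⟨h1, h2⟩
    have m1 : (-rightEnd (_root_.reflect P) y, y) ∈ P := h.reflect.rightEnd_mem hc hd
    have hcv : Convex ℝ ((fun x => (x, y)) ⁻¹' P) := by
      intro a ha b hb s t hs ht hst
      have := h.convex ha hb hs ht hst
      simpa [← add_mul, hst] using this
    exact hcv.ordConnected.out m1 (h.rightEnd_mem hc hd) ⟨h1, h2⟩

end HullRows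

end Polygon

namespace HullRows

variable {P : Set (ℝ × ℝ)} {V : Finset (ℤ × ℤ)} {c d : ℤ}

/-- The width of the horizontal slice of `P` at height `y`. -/
def _root_.rowWidth (P : Set (ℝ × ℝ)) (y : ℝ) : ℝ := rightEnd P y + rightEnd (_root_.reflect P) y

lemma rowWidth_nonneg (h : HullRows P V c d) {y : ℝ} (hc : (c : ℝ) ≤ y) (hd : y ≤ d) :
    0 ≤ rowWidth P y := by
  obtain ⟨x, hx⟩ := h.exists_mem_row hc hd
  obtain ⟨h1, h2⟩ := (h.mem_iff hc hd).1 hx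
  unfold rowWidth
  linarith

lemma rowWidth_affine (h : HullRows P V c d) {j : ℤ} (hc : c ≤ j) (hd : j + 1 ≤ d) {y : ℝ}
    (h0 : j ≤ y) (h1 : y ≤ j + 1) :
    rowWidth P y = (rowWidth P j - j * (rowWidth P (j + 1) - rowWidth P j)) +
      (rowWidth P (j + 1) - rowWidth P j) * y := by
  have e1 := h.rightEnd_affine hc hd (t := y - j) (by linarith) (by linarith)
  have e2 := h.reflect.rightEnd_affine hc hd (t := y - j) (by linarith) (by linarith)
  rw [add_sub_cancel] at e1 e2
  unfold rowWidth
  rw [e1, e2]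
  ring

lemma intervalIntegrable_rowWidth (h : HullRows P V c d) {j : ℤ} (hc : c ≤ j) (hd : j + 1 ≤ d) :
    IntervalIntegrable (rowWidth P) MeasureTheory.volume j (j + 1) := by
  refine IntervalIntegrable.congr ?_ ((by fun_prop : Continuous fun y : ℝ =>
    (rowWidth P j - j * (rowWidth P (j + 1) - rowWidth P j)) +
      (rowWidth P (j + 1) - rowWidth P j) * y).intervalIntegrable _ _)
  intro y hy
  rw [Set.uIoc_of_le (by linarith)] at hy
  exact (h.rowWidth_affine hc hd hy.1.le hy.2).symm

lemma integral_rowWidth (h : HullRows P V c d) {j : ℤ} (hc : c ≤ j) (hd : j + 1 ≤ d) :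
    ∫ y in (j : ℝ)..(j + 1), rowWidth P y = (rowWidth P j + rowWidth P (j + 1)) / 2 := by
  rw [intervalIntegral.integral_congr (g := fun y : ℝ =>
    (rowWidth P j - j * (rowWidth P (j + 1) - rowWidth P j)) +
      (rowWidth P (j + 1) - rowWidth P j) * y)]
  · rw [intervalIntegral.integral_add (continuous_const.intervalIntegrable _ _)
      ((continuous_const_mul _).intervalIntegrable _ _),
      intervalIntegral.integral_const_mul, integral_id, intervalIntegral.integral_const,
      smul_eq_mul]
    ring
  · intro y hy
    rw [Set.uIcc_of_le (by linarith)] at hy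
    exact h.rowWidth_affine hc hd hy.1 hy.2

lemma areaOf_eq_integral (h : HullRows P V c d) (hcd : c ≤ d)
    (hw : IntervalIntegrable (rowWidth P) MeasureTheory.volume c d) :
    areaOf P = ∫ y in (c : ℝ)..d, rowWidth P y := by
  have hcd' : (c : ℝ) ≤ d := by exact_mod_cast hcd
  have hslice : ∀ y : ℝ, MeasureTheory.volume ((fun x => (x, y)) ⁻¹' P) =
      (Set.Icc (c : ℝ) d).indicator (fun y => ENNReal.ofReal (rowWidth P y)) y := by
    intro y
    by_cases hy : y ∈ Set.Icc (c : ℝ) d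
    · have e : (fun x => (x, y)) ⁻¹' P =
          Set.Icc (-rightEnd (_root_.reflect P) y) (rightEnd P y) :=
        Set.ext fun x => h.mem_iff hy.1 hy.2
      rw [e, Real.volume_Icc, Set.indicator_of_mem hy, sub_neg_eq_add, rowWidth]
    · have e : (fun x => (x, y)) ⁻¹' P = ∅ :=
        Set.eq_empty_of_forall_notMem fun x hx => hy ⟨h.le_snd hx, h.snd_le hx⟩
      rw [e, MeasureTheory.measure_empty, Set.indicator_of_notMem hy]
  rw [areaOf, MeasureTheory.Measure.volume_eq_prod,
    MeasureTheory.Measure.prod_apply_symm h.isCompact.measurableSet]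
  simp only [hslice]
  rw [MeasureTheory.lintegral_indicator measurableSet_Icc,
    ← MeasureTheory.ofReal_integral_eq_lintegral_ofReal
      ((intervalIntegrable_iff_integrableOn_Icc_of_le hcd').1 hw)
      ((MeasureTheory.ae_restrict_iff' measurableSet_Icc).2
        (.of_forall fun y hy => h.rowWidth_nonneg hy.1 hy.2)),
    ENNReal.toReal_ofReal (MeasureTheory.setIntegral_nonneg measurableSet_Icc
      fun y hy => h.rowWidth_nonneg hy.1 hy.2),
    MeasureTheory.integral_Icc_eq_integral_Ioc, intervalIntegral.integral_of_le hcd']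

/-- The area of `P` by the trapezoidal rule. -/
lemma areaOf_eq_sum (h : HullRows P V c d) {n : ℕ} (hn : c + n = d) :
    areaOf P = ∑ i ∈ Finset.range n, (rowWidth P (c + i) + rowWidth P (c + (i + 1 : ℕ))) / 2 := by
  have hw : ∀ i < n, IntervalIntegrable (rowWidth P) MeasureTheory.volume
      (c + i) (c + (i + 1 : ℕ)) := fun i hi => by
    have := h.intervalIntegrable_rowWidth (j := c + i) (by omega) (by omega)
    push_cast at this ⊢
    rwa [add_assoc] at this
  have htot := IntervalIntegrable.trans_iterate (a := fun i : ℕ => (c : ℝ) + i) hw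
  have hd : (c : ℝ) + n = d := by exact_mod_cast hn
  simp only [Nat.cast_zero, add_zero, hd] at htot
  rw [h.areaOf_eq_integral (by omega) htot]
  have := intervalIntegral.sum_integral_adjacent_intervals (a := fun i : ℕ => (c : ℝ) + i) hw
  simp only [Nat.cast_zero, add_zero, hd] at this
  rw [← this]
  refine Finset.sum_congr rfl fun i hi => ?_
  have := h.integral_rowWidth (j := c + i) (by omega) (by have := Finset.mem_range.1 hi; omega)
  push_cast at this ⊢
  rw [add_assoc] at this
  exact this

/-- The number of lattice points of a slice with lattice ends. -/
lemma ncard_row (h : HullRows P V c d) {j : ℤ} (hc : c ≤ j) (hd : j ≤ d) {x x' : ℤ}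
    (hx : (x : ℝ) = rightEnd P j) (hx' : (x' : ℝ) = rightEnd (_root_.reflect P) j) :
    (({k : ℤ × ℤ | rpt k ∈ P ∧ k.2 = j}.ncard - 1 : ℕ) : ℝ) = rowWidth P j := by
  have hc' : (c : ℝ) ≤ j := by exact_mod_cast hc
  have hd' : (j : ℝ) ≤ d := by exact_mod_cast hd
  have e : {k : ℤ × ℤ | rpt k ∈ P ∧ k.2 = j} =
      (fun m : ℤ => (m, j)) '' (Finset.Icc (-x') x : Finset ℤ) := by
    ext ⟨m, i⟩
    simp only [Set.mem_ofPred_eq, Set.mem_image, Finset.coe_Icc, Set.mem_Icc, Prod.mk.injEq]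
    constructor
    · rintro ⟨hm, rfl⟩
      obtain ⟨h1, h2⟩ := (h.mem_iff hc' hd').1 hm
      rw [← hx'] at h1
      rw [← hx] at h2
      exact ⟨m, ⟨by exact_mod_cast h1, by exact_mod_cast h2⟩, rfl, rfl⟩
    · rintro ⟨m, ⟨h1, h2⟩, rfl, rfl⟩
      refine ⟨(h.mem_iff hc' hd').2 ?_, rfl⟩
      rw [← hx', ← hx]
      exact ⟨by exact_mod_cast h1, by exact_mod_cast h2⟩
  have h0 := h.rowWidth_nonneg hc' hd'
  rw [rowWidth, ← hx, ← hx'] at h0 ⊢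
  have h0' : 0 ≤ x + x' := by exact_mod_cast h0
  rw [e, Set.ncard_image_of_injective _ (fun a b hab => (Prod.mk.inj hab).1),
    Set.ncard_coe_finset, Int.card_Icc]
  have : (((x + 1 - -x').toNat - 1 : ℕ) : ℤ) = x + x' := by omega
  exact_mod_cast this

lemma lenFace_up (h : HullRows P V c d) (hcd : c < d) :
    (lenFace P (0, 1) : ℝ) = rowWidth P d := by
  obtain ⟨k, hk, hkd, hkr⟩ := h.exists_vertex_of_break hcd hcd.le le_rfl (.inr (.inl rfl))
  obtain ⟨k', hk', hkd', hkr'⟩ :=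
    h.reflect.exists_vertex_of_break hcd hcd.le le_rfl (.inr (.inl rfl))
  rw [← h.ncard_row hcd.le le_rfl hkr hkr', lenFace]
  congr 3
  ext m
  simp only [latticePts, face, rpt, Set.mem_ofPred_eq]
  refine and_congr_right fun hm => ⟨fun H => le_antisymm ?_ ?_, fun H q hq => ?_⟩
  · have : (m.2 : ℝ) ≤ d := h.snd_le hm
    exact_mod_cast this
  · have := H (rpt k) (h.rpt_mem hk)
    simp only [rpt, hkd] at this
    norm_num at this
    exact this
  · have := h.snd_le hq
    simp [H, this]

lemma lenFace_down (h : HullRows P V c d) (hcd : c < d) :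
    (lenFace P (0, -1) : ℝ) = rowWidth P c := by
  obtain ⟨k, hk, hkd, hkr⟩ := h.exists_vertex_of_break hcd le_rfl hcd.le (.inl rfl)
  obtain ⟨k', hk', hkd', hkr'⟩ :=
    h.reflect.exists_vertex_of_break hcd le_rfl hcd.le (.inl rfl)
  rw [← h.ncard_row le_rfl hcd.le hkr hkr', lenFace]
  congr 3
  ext m
  simp only [latticePts, face, rpt, Set.mem_ofPred_eq]
  refine and_congr_right fun hm => ⟨fun H => le_antisymm ?_ ?_, fun H q hq => ?_⟩
  · have := H (rpt k) (h.rpt_mem hk)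
    simp only [rpt, hkd] at this
    norm_num at this
    exact this
  · have : (c : ℝ) ≤ m.2 := h.le_snd hm
    exact_mod_cast this
  · have := h.le_snd hq
    simp [H, this]

/-- A row between two rows that contain unit segments contains a lattice point. -/
lemma exists_lattice_of_unit_segments (h : HullRows P V c d) {x y x' y' : ℤ}
    (h₁ : rpt (x, y) ∈ P) (h₂ : rpt (x + 1, y) ∈ P) (h₃ : rpt (x', y') ∈ P)
    (h₄ : rpt (x' + 1, y') ∈ P) {j : ℤ} (hj : y ≤ j) (hj' : j ≤ y') :
    ∃ m : ℤ, rpt (m, j) ∈ P := by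
  rcases hj.eq_or_lt with rfl | hlt
  · exact ⟨_, h₁⟩
  have hyy : (0 : ℝ) < y' - y := by
    have : (y : ℝ) < y' := by exact_mod_cast hlt.trans_le hj'
    linarith
  have r1 : (y : ℝ) ≤ j := by exact_mod_cast hj
  have r2 : (j : ℝ) ≤ y' := by exact_mod_cast hj'
  set t : ℝ := (j - y) / (y' - y) with ht
  have t0 : 0 ≤ t := div_nonneg (by linarith) hyy.le
  have t1 : t ≤ 1 := by rw [ht, div_le_one hyy]; linarith
  have m1 := h.combo_mem h₁ h₃ t0 t1
  have m2 := h.combo_mem h₂ h₄ t0 t1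
  have e : (1 - t) * (y : ℝ) + t * y' = j := by rw [ht]; field_simp; ring
  simp only [e] at m1 m2
  set X : ℝ := (1 - t) * x + t * x'
  have e2 : (1 - t) * ((x + 1 : ℤ) : ℝ) + t * ((x' + 1 : ℤ) : ℝ) = X + 1 := by
    simp only [X]; push_cast; ring
  rw [e2] at m2
  have c1 : (c : ℝ) ≤ j := h.le_snd m1
  have c2 : (j : ℝ) ≤ d := h.snd_le m1
  obtain ⟨b1, -⟩ := (h.mem_iff c1 c2).1 m1
  obtain ⟨-, b2⟩ := (h.mem_iff c1 c2).1 m2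
  refine ⟨⌈X⌉, (h.mem_iff c1 c2).2 ⟨b1.trans (Int.le_ceil X), ?_⟩⟩
  exact ((Int.ceil_lt_add_one X).le).trans b2

end HullRows

lemma Contains5Delta.exists_forall_mem {P : Set (ℝ × ℝ)} (h : Contains5Delta P) :
    ∃ t : ℤ × ℤ, ∀ i j : ℕ, i + j ≤ 5 → rpt (t.1 + i, t.2 + j) ∈ P := by
  obtain ⟨t, ht⟩ := h
  refine ⟨t, fun i j hij => ht ?_⟩
  have hij' : (i : ℝ) + j ≤ 5 := by exact_mod_cast hij
  have hmem : ((i / 5 : ℝ), (j / 5 : ℝ)) ∈ stdTriangle := by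
    have hc : Convex ℝ stdTriangle := convex_convexHull ℝ _
    have h0 : ((0 : ℝ), (0 : ℝ)) ∈ stdTriangle := subset_convexHull ℝ _ (by simp)
    have h1 : ((1 : ℝ), (0 : ℝ)) ∈ stdTriangle := subset_convexHull ℝ _ (by simp)
    have h2 : ((0 : ℝ), (1 : ℝ)) ∈ stdTriangle := subset_convexHull ℝ _ (by simp)
    have := hc.sum_mem (t := Finset.univ)
      (w := ![(1 - i / 5 - j / 5 : ℝ), (i / 5 : ℝ), (j / 5 : ℝ)])
      (z := ![((0 : ℝ), (0 : ℝ)), (1, 0), (0, 1)]) (by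
        intro k _
        fin_cases k
        · simp; linarith
        · simp; positivity
        · simp; positivity) (by simp [Fin.sum_univ_three]; ring) (by
        intro k _
        fin_cases k <;> simpa)
    simpa [Fin.sum_univ_three] using this
  refine ⟨_, ⟨_, hmem, rfl⟩, ?_⟩
  simp [rpt, mul_div_cancel₀]

lemma IsLatticePolygon.exists_hullRows {P : Set (ℝ × ℝ)} (h : IsLatticePolygon P) :
    ∃ V c d, HullRows P V c d := by
  obtain ⟨V, hne, rfl⟩ := h
  obtain ⟨a, ha, hamin⟩ := V.exists_min_image (fun k => k.2) hne
  obtain ⟨b, hb, hbmax⟩ := V.exists_max_image (fun k => k.2) hne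
  exact ⟨V, a.2, b.2, rfl, hamin, hbmax, ⟨a, ha, rfl⟩, ⟨b, hb, rfl⟩⟩

lemma HullRows.exists_unit_segment {P : Set (ℝ × ℝ)} {V : Finset (ℤ × ℤ)} {c d : ℤ}
    (h : HullRows P V c d) {k k' : ℤ × ℤ} (hk : rpt k ∈ P) (hk' : rpt k' ∈ P) (hne : k ≠ k')
    (hrow : k.2 = k'.2) : ∃ x : ℤ, rpt (x, k.2) ∈ P ∧ rpt (x + 1, k.2) ∈ P := by
  wlog hlt : k.1 < k'.1 generalizing k k'
  · have hne' : k.1 ≠ k'.1 := fun e => hne (Prod.ext e hrow)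
    have := this hk' hk hne.symm hrow.symm (by omega)
    rwa [← hrow] at this
  have hc : (c : ℝ) ≤ k.2 := h.le_snd hk
  have hd : (k.2 : ℝ) ≤ d := h.snd_le hk
  have m1 := (h.mem_iff hc hd).1 hk
  have m2 : rpt (k'.1, k.2) ∈ P := by rw [hrow]; exact hk'
  have m2 := (h.mem_iff hc hd).1 m2
  have h1 : (k.1 : ℝ) + 1 ≤ k'.1 := by exact_mod_cast hlt
  refine ⟨k.1, hk, (h.mem_iff hc hd).2 ?_⟩
  push_cast
  exact ⟨by linarith [m1.1], by linarith [m2.2]⟩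

lemma finite_latticePts {P : Set (ℝ × ℝ)} (hP : Bornology.IsBounded P) :
    (latticePts P).Finite := by
  obtain ⟨r, hr⟩ := hP.exists_norm_le
  refine (Set.finite_Icc (-⌈r⌉, -⌈r⌉) (⌈r⌉, ⌈r⌉)).subset fun k hk => ?_
  have h := hr _ hk
  rw [rpt, Prod.norm_def, max_le_iff, Real.norm_eq_abs, Real.norm_eq_abs, abs_le, abs_le] at h
  obtain ⟨⟨h1, h2⟩, h3, h4⟩ := h
  have hc := Int.le_ceil r
  refine ⟨⟨?_, ?_⟩, ?_, ?_⟩ <;> rify <;> simp only at * <;> linarith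

section Evaluation

variable {S : Set (ℤ × ℤ)} [Fintype S] {f : MvPolynomial (Fin 2) ℂ}

/-- Sums over the support of `f` as sums over a set of lattice points containing it. -/
lemma sum_support_eq_sum_coeffAt (hf : SuppIn f S) (hS : ∀ k ∈ S, 0 ≤ k.1 ∧ 0 ≤ k.2)
    (G : ℕ → ℕ → ℂ) :
    ∑ m ∈ f.support, f.coeff m * G (m 0) (m 1) =
      ∑ k : S, coeffAt f k * G k.1.1.toNat k.1.2.toNat := by
  classical
  let expo : S → Fin 2 →₀ ℕ := fun k =>
    Finsupp.single 0 k.1.1.toNat + Finsupp.single 1 k.1.2.toNat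
  have e0 : ∀ k, expo k 0 = k.1.1.toNat := fun k => by simp [expo]
  have e1 : ∀ k, expo k 1 = k.1.2.toNat := fun k => by simp [expo]
  have hinj : Function.Injective expo := fun k k' hkk => by
    have h0 := congrArg (· 0) hkk
    have h1 := congrArg (· 1) hkk
    simp only [e0, e1] at h0 h1
    have := hS k k.2
    have := hS k' k'.2
    exact Subtype.ext (Prod.ext (by omega) (by omega))
  have hsub : f.support ⊆ Finset.univ.image expo := fun m hm => by
    refine Finset.mem_image.2 ⟨⟨_, hf m hm⟩, Finset.mem_univ _, ?_⟩
    ext i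
    fin_cases i
    · simp [expo]
    · simp [expo]
  rw [Finset.sum_subset hsub (fun m _ hm => by rw [notMem_support_iff.1 hm, zero_mul]),
    Finset.sum_image hinj.injOn]
  refine Finset.sum_congr rfl fun k _ => ?_
  rw [e0, e1, coeffAt, if_pos (hS k k.2)]

lemma evalP_eq_sum (hf : SuppIn f S) (hS : ∀ k ∈ S, 0 ≤ k.1 ∧ 0 ≤ k.2) (x y : ℂ) :
    evalP f (x, y) = ∑ k : S, coeffAt f k * (x ^ k.1.1.toNat * y ^ k.1.2.toNat) := by
  rw [← sum_support_eq_sum_coeffAt hf hS fun a b => x ^ a * y ^ b, evalP, eval_eq']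
  simp

lemma mul_evalP_pderiv_eq_sum (hf : SuppIn f S) (hS : ∀ k ∈ S, 0 ≤ k.1 ∧ 0 ≤ k.2) (x y : ℂ) :
    y * evalP (pderiv 1 f) (x, y) =
      ∑ k : S, coeffAt f k * (k.1.2.toNat * (x ^ k.1.1.toNat * y ^ k.1.2.toNat)) := by
  rw [← sum_support_eq_sum_coeffAt hf hS fun a b => b * (x ^ a * y ^ b)]
  have e : y * evalP (pderiv 1 f) (x, y) = evalP (X 1 * pderiv 1 f) (x, y) := by
    simp [evalP]
  have e' : X 1 * pderiv 1 f = ∑ m ∈ f.support, m 1 • monomial m (f.coeff m) := by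
    conv_lhs => rw [f.as_sum]
    simp only [map_sum, Finset.mul_sum, X_mul_pderiv_monomial]
  rw [e, e', evalP, map_sum]
  refine Finset.sum_congr rfl fun m _ => ?_
  rw [map_nsmul, eval_monomial, Finsupp.prod_fintype _ _ (by simp)]
  simp
  ring

/-- The points with vertical tangent are the common zeros of the weighted sums, for exponents
shifted vertically. -/
lemma verticalTangents_eq_tangencySet (hf : SuppIn f S) (hS : ∀ k ∈ S, 0 ≤ k.1 ∧ 0 ≤ k.2) {c : ℕ}
    (hc : ∀ k ∈ S, (c : ℤ) ≤ k.2) :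
    {p | p ∈ Torus ∧ evalP f p = 0 ∧ evalP (pderiv 1 f) p = 0} =
      tangencySet (fun k : S => k.1.1.toNat) (fun k : S => (k.1.2 - c).toNat)
        (fun k => coeffAt f k) := by
  ext ⟨x, y⟩
  simp only [Torus, tangencySet, Set.mem_ofPred_eq, and_assoc]
  refine and_congr_right fun _ => and_congr_right fun hy => ?_
  have hsplit : ∀ k : S, k.1.2.toNat = c + (k.1.2 - c).toNat := fun k => by
    have := hc k k.2
    omega
  set w₀ := wtSum (fun k : S => k.1.1.toNat) (fun k : S => (k.1.2 - c).toNat) (fun _ => 1)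
    (fun k => coeffAt f k) x y with hw₀
  set w₁ := wtSum (fun k : S => k.1.1.toNat) (fun k : S => (k.1.2 - c).toNat)
    (fun k => ((k.1.2 - c).toNat : ℂ)) (fun k => coeffAt f k) x y with hw₁
  have h0 : evalP f (x, y) = y ^ c * w₀ := by
    rw [evalP_eq_sum hf hS, hw₀, wtSum, Finset.mul_sum]
    refine Finset.sum_congr rfl fun k _ => ?_
    rw [hsplit k, pow_add]
    ring
  have h1 : y * evalP (pderiv 1 f) (x, y) = y ^ c * (c * w₀ + w₁) := by
    rw [mul_evalP_pderiv_eq_sum hf hS, hw₀, hw₁, wtSum, wtSum, Finset.mul_sum,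
      ← Finset.sum_add_distrib, Finset.mul_sum]
    refine Finset.sum_congr rfl fun k _ => ?_
    rw [hsplit k, pow_add]
    push_cast
    ring
  have hyc : y ^ c ≠ 0 := pow_ne_zero _ hy
  rw [h0, mul_eq_zero_iff_left hyc]
  refine and_congr_right fun hz => ?_
  rw [← mul_eq_zero_iff_left hy, h1, mul_eq_zero_iff_left hyc, hz, mul_zero, zero_add]

end Evaluation

theorem count_vertical_tangents (P : Set (ℝ × ℝ)) (hP : IsLatticePolygon P)
    (hpos : P ⊆ {p : ℝ × ℝ | 0 ≤ p.1 ∧ 0 ≤ p.2}) (h5 : Contains5Delta P) :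
    GenericOn (latticePts P) (fun f =>
      {p | p ∈ Torus ∧ evalP f p = 0 ∧ evalP (pderiv 1 f) p = 0}.Finite ∧
      ({p | p ∈ Torus ∧ evalP f p = 0 ∧ evalP (pderiv 1 f) p = 0}.ncard : ℝ)
        = 2 * areaOf P - (lenFace P (0, -1) : ℝ) - (lenFace P (0, 1) : ℝ)) := by
  obtain ⟨V, c, d, h⟩ := hP.exists_hullRows
  obtain ⟨t, ht⟩ := h5.exists_forall_mem
  have hS : ∀ k ∈ latticePts P, 0 ≤ k.1 ∧ 0 ≤ k.2 := fun k hk => by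
    have : (0 : ℝ) ≤ k.1 ∧ (0 : ℝ) ≤ k.2 := hpos hk
    exact_mod_cast this
  have hrow : ∀ k ∈ latticePts P, c ≤ k.2 ∧ k.2 ≤ d := fun k hk => by
    have : (c : ℝ) ≤ k.2 ∧ (k.2 : ℝ) ≤ d := ⟨h.le_snd hk, h.snd_le hk⟩
    exact_mod_cast this
  have hc0 : 0 ≤ c := by
    obtain ⟨k, hk, rfl⟩ := h.exists_bot
    exact (hS k (h.rpt_mem hk)).2
  lift c to ℕ using hc0
  have ht0 := hrow _ (ht 0 0 (by norm_num))
  have ht5 := hrow _ (ht 0 5 (by norm_num))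
  have ht1 := (hS _ (ht 0 0 (by norm_num))).1
  simp only [Nat.cast_zero, add_zero] at ht0 ht1
  simp only [Nat.cast_ofNat] at ht5
  obtain ⟨N, hN⟩ : ∃ N : ℕ, (c : ℤ) + (N + 1 : ℕ) = d := ⟨(d - c - 1).toNat, by omega⟩
  have hcd : (c : ℤ) < d := by omega
  have : Fintype (latticePts P) := (finite_latticePts h.isCompact.isBounded).fintype
  let px : latticePts P → ℕ := fun k => k.1.1.toNat
  let iy : latticePts P → ℕ := fun k => (k.1.2 - c).toNat
  have hpx : ∀ k, (px k : ℝ) = k.1.1 := fun k => by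
    have := hS _ k.2
    have e : (px k : ℤ) = k.1.1 := by simp only [px]; omega
    exact_mod_cast e
  have hiy : ∀ k, (iy k : ℤ) = k.1.2 - c := fun k => by
    have := hrow _ k.2
    simp only [iy]; omega
  have hiy' : ∀ k, ((c : ℤ) : ℝ) + iy k = k.1.2 := fun k => by
    have : (c : ℤ) + iy k = k.1.2 := by rw [hiy]; ring
    exact_mod_cast this
  obtain ⟨D, hD, H⟩ := exists_generic_ncard_tangencySet (px := px) (iy := iy) (N := N) (by omega)
    (r := fun i => rightEnd P ((c : ℤ) + i)) (r' := fun i => rightEnd (reflect P) ((c : ℤ) + i))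
    (p := t.1.toNat) (l := (t.2 - c).toNat)
    (e := fun j => ⟨(t.1, t.2 + (j : ℕ)), by
      simpa [latticePts] using ht 0 j (by omega)⟩)
    (fun k => by
      have := hrow _ k.2
      have := hiy k
      omega)
    (fun k k' hkk => by
      obtain ⟨e1, e2⟩ := Prod.mk.inj hkk
      have := hiy k
      have := hiy k'
      have := hS _ k.2
      have := hS _ k'.2
      simp only [px] at e1
      exact Subtype.ext (Prod.ext (by omega) (by omega)))
    (h.discreteConcave_rightEnd hN)
    (fun k => by
      simp only [hpx, hiy']
      exact h.le_rightEnd k.2)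
    (fun i hi hb => by
      obtain ⟨k, hk, hk2, hk1⟩ := h.exists_vertex_of_isBreak hN hi hb
      refine ⟨⟨k, h.rpt_mem hk⟩, ?_, ?_⟩
      · simp only [iy]; omega
      · rw [hpx]; exact hk1)
    (h.reflect.discreteConcave_rightEnd hN)
    (fun k => by
      simp only [hpx, hiy']
      refine h.reflect.le_rightEnd ?_
      have := k.2
      simpa [reflect, latticePts, rpt] using this)
    (fun i hi hb => by
      obtain ⟨k, hk, hk2, hk1⟩ := h.reflect.exists_vertex_of_isBreak hN hi hb
      obtain ⟨k, hkV, rfl⟩ := Finset.mem_image.1 hk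
      refine ⟨⟨k, h.rpt_mem hkV⟩, ?_, ?_⟩
      · simp only [iy]; omega
      · rw [hpx]
        push_cast at hk1
        exact hk1)
    (fun j => rfl)
    (fun j => by simp only [iy]; omega)
    ⟨⟨(t.1 + 1, t.2), by simpa [latticePts] using ht 1 0 (by norm_num)⟩,
      by simp only [px]; omega, by simp only [iy]⟩
    (by
      by_contra! hcon
      obtain ⟨hno, k, k', hk, hk', hne⟩ := hcon
      have := hiy k
      have := hiy k'
      obtain ⟨x, h1, h2⟩ := h.exists_unit_segment k.2 k'.2 (fun e => hne (Subtype.ext e))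
        (by omega)
      obtain ⟨m, hm⟩ := h.exists_lattice_of_unit_segments (j := d - 1)
        (by simpa using ht 0 0 (by norm_num)) (by simpa using ht 1 0 (by norm_num)) h1 h2
        (by omega) (by omega)
      exact hno ⟨(m, d - 1), hm⟩ (by simp only [iy]; omega))
    (by
      by_contra! hcon
      obtain ⟨hno, k, k', hk, hk', hne⟩ := hcon
      have := hiy k
      have := hiy k'
      obtain ⟨x, h1, h2⟩ := h.exists_unit_segment k.2 k'.2 (fun e => hne (Subtype.ext e))
        (by omega)
      obtain ⟨m, hm⟩ := h.exists_lattice_of_unit_segments (j := c + 1) h1 h2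
        (x' := t.1) (y' := t.2 + 4)
        (by simpa using ht 0 4 (by norm_num)) (by simpa using ht 1 4 (by norm_num))
        (by omega) (by omega)
      exact hno ⟨(m, c + 1), hm⟩ (by simp only [iy]; omega))
  refine ⟨D, hD, fun f hf hDf => ?_⟩
  beta_reduce
  rw [verticalTangents_eq_tangencySet hf hS fun k hk => (hrow k hk).1]
  obtain ⟨hfin, hcard⟩ := H _ hDf
  refine ⟨hfin, hcard.trans ?_⟩
  have hd : ((c : ℤ) : ℝ) + (N + 1 : ℕ) = d := by exact_mod_cast hN
  rw [h.lenFace_down hcd, h.lenFace_up hcd, h.areaOf_eq_sum hN, ← Finset.sum_div,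
    mul_div_cancel₀ _ (two_ne_zero' ℝ)]
  simp only [rowWidth, Finset.sum_add_distrib, hd, Nat.cast_zero, add_zero]
  ring

end
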